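/- Let n be a positive integer, U an open neighborhood of 0 in ℂ^n, and f_1, …, f_n holomorphic functions on U. Let h be a holomorphic function on U that vanishes at every point of the common zero set V(f_1, …, f_n) = {z ∈ U : f_1(z) = ⋯ = f_n(z) = 0}. Then the product h · J(f_1, …, f_n) belongs to the ideal (f_1, …, f_n) locally at 0: there exist an open neighborhood Ũ ⊆ U of 0 and holomorphic functions a_1, …, a_n on Ũ such that h · J(f_1, …, f_n) = a_1 f_1 + ⋯ + a_n f_n on Ũ. -/

import Mathlib

open TensorProduct

theorem hadamard_aux {σ k S Q : Type*} [Fintype σ] [DecidableEq σ] [CommRing k] [CommRing S] [CommRing Q]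
    [Algebra k S] [Algebra k Q] (μ : S →ₐ[k] Q) (z w : σ → S) (hzw : ∀ i, μ (z i) = μ (w i))
    (p : MvPolynomial σ k) :
    ∃ H : σ → S, MvPolynomial.aeval w p - MvPolynomial.aeval z p = ∑ j, H j * (w j - z j) ∧
      ∀ j, μ (H j) = MvPolynomial.aeval (fun i => μ (z i)) (MvPolynomial.pderiv j p) := by
  induction p using MvPolynomial.induction_on with
  | C a => exact ⟨0, by simp, by simp⟩
  | add p q hp hq =>
    obtain ⟨H, h1, h2⟩ := hp
    obtain ⟨K, h3, h4⟩ := hq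
    refine ⟨H + K, ?_, fun j => by simp [h2, h4]⟩
    simp only [map_add, Pi.add_apply, add_mul, Finset.sum_add_distrib, ← h1, ← h3]
    ring
  | mul_X p i hp =>
    obtain ⟨H, h1, h2⟩ := hp
    refine ⟨fun j => H j * w i + if j = i then MvPolynomial.aeval z p else 0, ?_, fun j => ?_⟩
    · have : ∀ j, (H j * w i + if j = i then MvPolynomial.aeval z p else 0) * (w j - z j)
          = w i * (H j * (w j - z j)) + if j = i then MvPolynomial.aeval z p * (w i - z i) else 0 := by
        intro j
        split_ifs with h
        · subst h; ring
        · ring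
      simp only [this, Finset.sum_add_distrib, ← Finset.mul_sum, ← h1]
      simp
      ring
    · have hc : MvPolynomial.aeval (fun i => μ (z i)) p = μ (MvPolynomial.aeval z p) := by
        rw [← MvPolynomial.comp_aeval]; rfl
      by_cases h : j = i
      · subst h
        simp [h2, ← hc, ← hzw, Derivation.leibniz]
        ring
      · simp [h2, hzw, Derivation.leibniz, h, MvPolynomial.pderiv_X_of_ne (Ne.symm h)]
        ring

theorem trace_aux {k Q : Type*} [Field k] [CommRing Q] [Algebra k Q] [Module.Finite k Q]
    (h : Q) (hh : IsNilpotent h) (D : Q ⊗[k] Q) :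
    LinearMap.trace Q (Q ⊗[k] Q) (LinearMap.mulLeft Q (D * (1 ⊗ₜ h))) = 0 := by
  induction D with
  | zero => simp
  | add x y hx hy =>
    have : LinearMap.mulLeft Q ((x + y) * (1 ⊗ₜ[k] h)) =
      LinearMap.mulLeft Q (x * (1 ⊗ₜ[k] h)) + LinearMap.mulLeft Q (y * (1 ⊗ₜ[k] h)) := by
        apply LinearMap.ext; intro u; simp only [LinearMap.mulLeft_apply, LinearMap.add_apply, add_mul]
    rw [this, map_add, hx, hy, add_zero]
  | tmul a b =>
    have : LinearMap.mulLeft Q ((a ⊗ₜ[k] b) * (1 ⊗ₜ[k] h)) =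
      a • (LinearMap.baseChange Q (LinearMap.mulLeft k (b * h))) := by
        ext; simp [smul_tmul', mul_assoc]
    rw [this, map_smul, LinearMap.trace_baseChange]
    have h0 : LinearMap.trace k Q (LinearMap.mulLeft k (b * h)) = 0 := by
      have : IsNilpotent (LinearMap.mulLeft k (b * h)) := by
        obtain ⟨m, hm⟩ := hh
        refine ⟨m, ?_⟩
        rw [LinearMap.pow_mulLeft, mul_pow, hm]; simp
      exact (LinearMap.isNilpotent_trace_of_isNilpotent this).eq_zero
    rw [h0]; simp

theorem kill_aux {S : Type*} [CommRing S] {n : ℕ} (M : Matrix (Fin n) (Fin n) S) (v : Fin n → S)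
    (h : M.mulVec v = 0) (j : Fin n) : M.det * v j = 0 := by
  have h1 : (M.adjugate * M).mulVec v = 0 := by
    rw [← Matrix.mulVec_mulVec, h, Matrix.mulVec_zero]
  rw [Matrix.adjugate_mul, Matrix.smul_mulVec, Matrix.one_mulVec] at h1
  simpa using congrFun h1 j

theorem jac_poly_aux {k Q : Type*} [Field k] {n : ℕ} [CommRing Q] [Algebra k Q] [Module.Finite k Q]
    (p : Fin n → MvPolynomial (Fin n) k) (h : MvPolynomial (Fin n) k)
    (q : MvPolynomial (Fin n) k →ₐ[k] Q) (hqs : Function.Surjective q)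
    (hq0 : ∀ i, q (p i) = 0) (hh : IsNilpotent (q h)) :
    q (h * Matrix.det (Matrix.of fun i j => MvPolynomial.pderiv j (p i))) = 0 := by
  let μ : Q ⊗[k] Q →ₐ[Q] Q := Algebra.TensorProduct.lmul'' k
  have hμt : ∀ a b : Q, μ (a ⊗ₜ[k] b) = a * b := by
    intro a b; exact Algebra.TensorProduct.lmul'_apply_tmul a b
  clear_value μ
  let z : Fin n → Q ⊗[k] Q := fun i => (q (.X i)) ⊗ₜ 1
  let w : Fin n → Q ⊗[k] Q := fun i => 1 ⊗ₜ (q (.X i))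
  have hz : ∀ f, MvPolynomial.aeval z f = (q f) ⊗ₜ[k] (1 : Q) := by
    intro f
    have : MvPolynomial.aeval z = (Algebra.TensorProduct.includeLeft : Q →ₐ[k] Q ⊗[k] Q).comp q := by
      ext; simp [z]
    rw [this]; rfl
  have hw : ∀ f, MvPolynomial.aeval w f = (1 : Q) ⊗ₜ[k] (q f) := by
    intro f
    have : MvPolynomial.aeval w = (Algebra.TensorProduct.includeRight : Q →ₐ[k] Q ⊗[k] Q).comp q := by
      ext; simp [w]
    rw [this]; rfl
  have hμ : ∀ i, μ (z i) = q (.X i) := by intro i; simp [hμt, z]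
  have hzw : ∀ i, (μ.restrictScalars k) (z i) = (μ.restrictScalars k) (w i) := by
    intro i; simp [hμt, z, w]
  have hev : ∀ f, MvPolynomial.aeval (fun i => (μ.restrictScalars k) (z i)) f = q f := by
    intro f
    have : MvPolynomial.aeval (fun i => (μ.restrictScalars k) (z i)) = q := by
      ext i; simp [hμ]
    rw [this]
  choose H hH1 hH2 using fun i => hadamard_aux (μ.restrictScalars k) z w hzw (p i)
  let M : Matrix (Fin n) (Fin n) (Q ⊗[k] Q) := Matrix.of H
  have hMv : M.mulVec (w - z) = 0 := by
    ext i
    have := hH1 i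
    rw [hz, hw, hq0] at this
    simp at this
    simp [Matrix.mulVec, dotProduct, M, ← this]
  have hkill : ∀ j, M.det * (w j - z j) = 0 := kill_aux M (w - z) hMv
  have hkill2 : ∀ b : Q, M.det * (1 ⊗ₜ[k] b) = M.det * (b ⊗ₜ[k] 1) := by
    intro b
    obtain ⟨f, rfl⟩ := hqs b
    obtain ⟨K, hK, -⟩ := hadamard_aux (μ.restrictScalars k) z w hzw f
    rw [← sub_eq_zero, ← mul_sub, ← hz, ← hw, hK, Finset.mul_sum]
    refine Finset.sum_eq_zero fun j _ => ?_
    rw [mul_left_comm, hkill, mul_zero]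
  have hkill3 : ∀ u : Q ⊗[k] Q, M.det * u = μ u • M.det := by
    intro u
    induction u with
    | zero => simp
    | add x y hx hy => rw [mul_add, hx, hy, map_add, add_smul]
    | tmul a b =>
      have : a ⊗ₜ[k] b = ((1 : Q) ⊗ₜ[k] b) * (a ⊗ₜ[k] (1 : Q)) := by simp
      rw [this, ← mul_assoc, hkill2, mul_assoc, map_mul, Algebra.smul_def, mul_comm, hμt, hμt]
      simp [mul_comm]
  have htr := trace_aux (q h) hh M.det
  have : LinearMap.mulLeft Q (M.det * (1 ⊗ₜ[k] q h)) = μ.toLinearMap.smulRight (q h • M.det) := by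
    apply LinearMap.ext
    intro u
    rw [LinearMap.mulLeft_apply, mul_assoc, hkill3, map_mul, hμt, one_mul, mul_comm, mul_smul]
    rfl
  rw [this, LinearMap.trace_smulRight] at htr
  have hdet : μ M.det = q (Matrix.det (Matrix.of fun i j => MvPolynomial.pderiv j (p i))) := by
    rw [AlgHom.map_det, AlgHom.map_det]
    congr 1
    ext i j
    have := hH2 i j
    rw [hev] at this
    simpa [M] using this
  simp only [AlgHom.toLinearMap_apply, map_smul, hdet, smul_eq_mul, ← map_mul] at htr
  exact htr

theorem finite_quot_aux {k : Type*} [Field k] {n : ℕ} (N : ℕ) (I : Ideal (MvPolynomial (Fin n) k))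
    (hI : (MvPolynomial.idealOfVars (Fin n) k) ^ (N + 1) ≤ I) :
    Module.Finite k (MvPolynomial (Fin n) k ⧸ I) := by
  have hq : Function.Surjective (Ideal.Quotient.mkₐ k I) := Ideal.Quotient.mkₐ_surjective k I
  have : Algebra.FiniteType k (MvPolynomial (Fin n) k ⧸ I) :=
    Algebra.FiniteType.of_surjective (Ideal.Quotient.mkₐ k I) hq
  have : Algebra.IsIntegral k (MvPolynomial (Fin n) k ⧸ I) := by
    constructor
    intro x
    obtain ⟨p, rfl⟩ := hq x
    induction p using MvPolynomial.induction_on with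
    | C a => exact (isIntegral_algebraMap (R := k) (x := a))
    | add p q hp hq => rw [map_add]; exact hp.add hq
    | mul_X p i hp =>
      rw [map_mul]
      refine hp.mul (IsIntegral.of_pow (n := N + 1) (Nat.succ_pos _) ?_)
      have : (Ideal.Quotient.mkₐ k I) (MvPolynomial.X i) ^ (N + 1) = 0 := by
        rw [← map_pow]
        refine Ideal.Quotient.eq_zero_iff_mem.2 (hI (Ideal.pow_mem_pow ?_ _))
        exact Ideal.subset_span ⟨i, rfl⟩
      rw [this]; exact isIntegral_zero
  exact Algebra.IsIntegral.finite

/-- power series all of whose coefficients of degree `< N` vanish -/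
def lowIdeal (σ k : Type*) [CommRing k] (N : ℕ) : Ideal (MvPowerSeries σ k) where
  carrier := {f | ∀ α, Finsupp.degree α < N → MvPowerSeries.coeff α f = 0}
  add_mem' := by
    intro a b ha hb α hα
    simp [ha α hα, hb α hα]
  zero_mem' := by intro α _; simp
  smul_mem' := by
    classical
    intro c f hf α hα
    rw [smul_eq_mul, MvPowerSeries.coeff_mul]
    refine Finset.sum_eq_zero fun p hp => ?_
    rw [Finset.HasAntidiagonal.mem_antidiagonal] at hp
    rw [hf p.2, mul_zero]
    refine lt_of_le_of_lt ?_ hα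
    rw [← hp, map_add]; omega

theorem jac_trunc {k : Type*} [Field k] {n : ℕ} (F : Fin n → MvPowerSeries (Fin n) k)
    (h : MvPowerSeries (Fin n) k) (h0 : MvPowerSeries.constantCoeff h = 0) (N : ℕ) :
    ∃ a : Fin n → MvPolynomial (Fin n) k, ∀ α, Finsupp.degree α < N →
      MvPowerSeries.coeff α (h * Matrix.det (Matrix.of fun i j => MvPowerSeries.pderiv k j (F i))) =
      MvPowerSeries.coeff α (∑ i, (a i : MvPowerSeries (Fin n) k) * F i) := by
  classical
  let p : Fin n → MvPolynomial (Fin n) k := fun i => MvPowerSeries.truncTotal (N + 2) (F i)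
  let g : MvPolynomial (Fin n) k := MvPowerSeries.truncTotal (N + 2) h
  let I : Ideal (MvPolynomial (Fin n) k) :=
    Ideal.span (Set.range p) ⊔ (MvPolynomial.idealOfVars (Fin n) k) ^ (N + 1)
  have hfin := finite_quot_aux (k := k) (n := n) N I le_sup_right
  have hp : ∀ i, p i ∈ I := fun i => Ideal.mem_sup_left (Ideal.subset_span ⟨i, rfl⟩)
  have hg : g ∈ MvPolynomial.idealOfVars (Fin n) k := by
    rw [← pow_one (MvPolynomial.idealOfVars (Fin n) k), MvPolynomial.mem_pow_idealOfVars_iff']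
    intro x hx
    have : x = 0 := by
      rw [← Finsupp.degree_eq_zero_iff]; omega
    subst this
    rw [MvPowerSeries.coeff_truncTotal _ (by simp)]
    simpa using h0
  have hJ := jac_poly_aux p g (Ideal.Quotient.mkₐ k I) (Ideal.Quotient.mkₐ_surjective k I)
    (fun i => Ideal.Quotient.eq_zero_iff_mem.2 (hp i))
    ⟨N + 1, by
      rw [← map_pow]
      exact Ideal.Quotient.eq_zero_iff_mem.2 (Ideal.mem_sup_right (Ideal.pow_mem_pow hg _))⟩
  have hJ' : g * Matrix.det (Matrix.of fun i j => MvPolynomial.pderiv j (p i)) ∈ I :=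
    Ideal.Quotient.eq_zero_iff_mem.1 hJ
  obtain ⟨u, hu, v, hv, huv⟩ := Submodule.mem_sup.1 hJ'
  obtain ⟨a, ha⟩ := (Ideal.mem_span_range_iff_exists_fun).1 hu
  refine ⟨a, ?_⟩
  let K := lowIdeal (Fin n) k N
  let π := Ideal.Quotient.mk K
  have key : ∀ f g : MvPowerSeries (Fin n) k, π f = π g ↔
      ∀ α, Finsupp.degree α < N → MvPowerSeries.coeff α f = MvPowerSeries.coeff α g := by
    intro f g
    rw [Ideal.Quotient.mk_eq_mk_iff_sub_mem]
    change (∀ α, _ → _) ↔ _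
    simp only [map_sub, sub_eq_zero]
  rw [← key]
  have hF : ∀ i, π (F i) = π (p i : MvPowerSeries (Fin n) k) := by
    intro i
    rw [key]
    intro α hα
    rw [MvPolynomial.coeff_coe, MvPowerSeries.coeff_truncTotal _ (by omega)]
  have hh : π h = π (g : MvPowerSeries (Fin n) k) := by
    rw [key]
    intro α hα
    rw [MvPolynomial.coeff_coe, MvPowerSeries.coeff_truncTotal _ (by omega)]
  have hdF : ∀ i j, π (MvPowerSeries.pderiv k j (F i)) =
      π (MvPolynomial.pderiv j (p i) : MvPolynomial (Fin n) k) := by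
    intro i j
    rw [key]
    intro α hα
    rw [← MvPowerSeries.pderiv_coe, MvPowerSeries.coeff_pderiv, MvPowerSeries.coeff_pderiv,
      MvPolynomial.coeff_coe, MvPowerSeries.coeff_truncTotal]
    rw [map_add, Finsupp.degree_single]; omega
  have hv0 : π (v : MvPowerSeries (Fin n) k) = 0 := by
    rw [← map_zero π, key]
    intro α hα
    rw [MvPolynomial.coeff_coe, (MvPolynomial.mem_pow_idealOfVars_iff' _ _).1 hv α (by omega)]
    simp
  let ψ : MvPolynomial (Fin n) k →+* MvPowerSeries (Fin n) k ⧸ K :=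
    π.comp (MvPolynomial.coeToMvPowerSeries.ringHom)
  have hψ : ∀ f, ψ f = π (f : MvPowerSeries (Fin n) k) := fun f => rfl
  have e1 : π (h * Matrix.det (Matrix.of fun i j => MvPowerSeries.pderiv k j (F i))) =
      ψ (g * Matrix.det (Matrix.of fun i j => MvPolynomial.pderiv j (p i))) := by
    rw [map_mul, map_mul, RingHom.map_det, RingHom.map_det, hh, hψ]
    congr 2
    ext i j
    simp [hdF, hψ]
  rw [e1, ← huv, map_add, hψ v, hv0, add_zero, ← ha, map_sum, map_sum]
  refine Finset.sum_congr rfl fun i _ => ?_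
  rw [map_mul, map_mul, hψ, hψ, hF]

open scoped ENNReal NNReal

/-- weighted `ℓ¹` norm of a power series -/
noncomputable def wN {σ : Type*} (x : (σ →₀ ℕ) → ℝ≥0∞) (f : MvPowerSeries σ ℂ) : ℝ≥0∞ :=
  ∑' α, ‖MvPowerSeries.coeff α f‖ₑ * x α

theorem wN_mono {σ : Type*} (x : (σ →₀ ℕ) → ℝ≥0∞) (f g : MvPowerSeries σ ℂ)
    (h : ∀ α, ‖MvPowerSeries.coeff α f‖ₑ ≤ ‖MvPowerSeries.coeff α g‖ₑ) : wN x f ≤ wN x g :=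
  ENNReal.tsum_le_tsum fun α => mul_le_mul_left (h α) _

theorem wN_mono' {σ : Type*} (x y : (σ →₀ ℕ) → ℝ≥0∞) (f : MvPowerSeries σ ℂ)
    (h : ∀ α, x α ≤ y α) : wN x f ≤ wN y f :=
  ENNReal.tsum_le_tsum fun α => mul_le_mul_right (h α) _

theorem wN_add {σ : Type*} (x : (σ →₀ ℕ) → ℝ≥0∞) (f g : MvPowerSeries σ ℂ) :
    wN x (f + g) ≤ wN x f + wN x g := by
  unfold wN
  rw [← ENNReal.tsum_add]
  refine ENNReal.tsum_le_tsum fun α => ?_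
  rw [← add_mul, map_add]
  exact mul_le_mul_left (enorm_add_le _ _) _

theorem wN_neg {σ : Type*} (x : (σ →₀ ℕ) → ℝ≥0∞) (f : MvPowerSeries σ ℂ) :
    wN x (-f) = wN x f := by
  simp [wN]

theorem wN_zero {σ : Type*} (x : (σ →₀ ℕ) → ℝ≥0∞) : wN x (0 : MvPowerSeries σ ℂ) = 0 := by
  simp [wN]

theorem wN_sum {σ ι : Type*} (x : (σ →₀ ℕ) → ℝ≥0∞) (s : Finset ι) (f : ι → MvPowerSeries σ ℂ) :
    wN x (∑ i ∈ s, f i) ≤ ∑ i ∈ s, wN x (f i) := by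
  classical
  induction s using Finset.induction_on with
  | empty => simp [wN_zero]
  | insert a s ha ih =>
    rw [Finset.sum_insert ha, Finset.sum_insert ha]
    exact (wN_add _ _ _).trans (add_le_add le_rfl ih)

theorem wN_mul {σ : Type*} (x : (σ →₀ ℕ) → ℝ≥0∞)
    (hx : ∀ a b, x (a + b) = x a * x b) (f g : MvPowerSeries σ ℂ) :
    wN x (f * g) ≤ wN x f * wN x g := by
  classical
  have h1 : wN x f * wN x g = ∑' p : (σ →₀ ℕ) × (σ →₀ ℕ),
      (‖MvPowerSeries.coeff p.1 f‖ₑ * x p.1) * (‖MvPowerSeries.coeff p.2 g‖ₑ * x p.2) := by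
    rw [ENNReal.tsum_prod']
    unfold wN
    rw [← ENNReal.tsum_mul_right]
    simp_rw [← ENNReal.tsum_mul_left]
  rw [h1, ← (Finset.HasAntidiagonal.sigmaAntidiagonalEquivProd (A := σ →₀ ℕ)).tsum_eq, ENNReal.tsum_sigma']
  unfold wN
  refine ENNReal.tsum_le_tsum fun α => ?_
  rw [tsum_fintype, MvPowerSeries.coeff_mul]
  calc _ ≤ (∑ p ∈ Finset.HasAntidiagonal.antidiagonal α,
        ‖MvPowerSeries.coeff p.1 f * MvPowerSeries.coeff p.2 g‖ₑ) * x α :=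
        mul_le_mul_left (enorm_sum_le _ _) _
    _ = ∑ p ∈ Finset.HasAntidiagonal.antidiagonal α,
        (‖MvPowerSeries.coeff p.1 f‖ₑ * x p.1) * (‖MvPowerSeries.coeff p.2 g‖ₑ * x p.2) := by
        rw [Finset.sum_mul]
        refine Finset.sum_congr rfl fun p hp => ?_
        rw [Finset.HasAntidiagonal.mem_antidiagonal] at hp
        rw [← hp, hx, enorm_mul]
        ring
    _ ≤ _ := by
        rw [← Finset.sum_coe_sort]
        exact le_of_eq rfl

theorem wN_finite {σ : Type*} (x : (σ →₀ ℕ) → ℝ≥0∞) (hx : ∀ a, x a ≠ ⊤) (f : MvPowerSeries σ ℂ)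
    (s : Finset (σ →₀ ℕ)) (hs : ∀ α ∉ s, MvPowerSeries.coeff α f = 0) : wN x f ≠ ⊤ := by
  unfold wN
  rw [tsum_eq_sum (s := s) (fun α hα => by simp [hs α hα])]
  exact (ENNReal.sum_ne_top).2 fun α _ => ENNReal.mul_ne_top enorm_ne_top (hx α)

/-- recursive solution of the division equation -/
noncomputable def uRec {σ : Type*} [DecidableEq σ] (w : (σ →₀ ℕ) → ℕ) (T : Finset (σ →₀ ℕ))
    (c : (σ →₀ ℕ) → (σ →₀ ℕ) → Prop) [∀ a b, Decidable (c a b)]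
    (G : (σ →₀ ℕ) → MvPowerSeries σ ℂ) (h : MvPowerSeries σ ℂ) (α : σ →₀ ℕ) : ℂ :=
  MvPowerSeries.coeff α h - ∑ τ ∈ T, ∑ p ∈ Finset.HasAntidiagonal.antidiagonal α,
    if _hw : w (p.1 + τ) < w α then
      (if c (p.1 + τ) τ then uRec w T c G h (p.1 + τ) else 0) * MvPowerSeries.coeff p.2 (G τ)
    else 0
termination_by w α
decreasing_by assumption

/-- the `τ`-quotient -/
noncomputable def Qop {σ : Type*} (c : (σ →₀ ℕ) → (σ →₀ ℕ) → Prop) [∀ a b, Decidable (c a b)]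
    (τ : σ →₀ ℕ) (u : MvPowerSeries σ ℂ) : MvPowerSeries σ ℂ :=
  fun γ => if c (γ + τ) τ then MvPowerSeries.coeff (γ + τ) u else 0

theorem coeff_Qop {σ : Type*} (c : (σ →₀ ℕ) → (σ →₀ ℕ) → Prop) [∀ a b, Decidable (c a b)]
    (τ : σ →₀ ℕ) (u : MvPowerSeries σ ℂ) (γ : σ →₀ ℕ) : MvPowerSeries.coeff γ (Qop c τ u) =
      if c (γ + τ) τ then MvPowerSeries.coeff (γ + τ) u else 0 := rfl

theorem Qop_norm {σ : Type*} (x : (σ →₀ ℕ) → ℝ≥0∞)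
    (hx : ∀ a b, x (a + b) = x a * x b) (T : Finset (σ →₀ ℕ))
    (c : (σ →₀ ℕ) → (σ →₀ ℕ) → Prop) [∀ a b, Decidable (c a b)]
    (hc : ∀ α τ τ', c α τ → c α τ' → τ = τ') (u : MvPowerSeries σ ℂ) :
    ∑ τ ∈ T, wN x (Qop c τ u) * x τ ≤ wN x u := by
  classical
  have h1 : ∀ τ, wN x (Qop c τ u) * x τ ≤
      ∑' β, if c β τ then ‖MvPowerSeries.coeff β u‖ₑ * x β else 0 := by
    intro τ
    unfold wN
    rw [← ENNReal.tsum_mul_right]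
    refine le_trans (le_of_eq ?_)
      (ENNReal.tsum_comp_le_tsum_of_injective (f := fun γ => γ + τ) (add_left_injective τ) _)
    refine tsum_congr fun γ => ?_
    rw [coeff_Qop]
    split_ifs
    · rw [hx, mul_assoc]
    · simp
  refine (Finset.sum_le_sum fun τ _ => h1 τ).trans ?_
  rw [← Summable.tsum_finsetSum (fun _ _ => ENNReal.summable)]
  refine ENNReal.tsum_le_tsum fun β => ?_
  by_cases hb : ∃ τ ∈ T, c β τ
  · obtain ⟨τ, hτ, hcτ⟩ := hb
    rw [Finset.sum_eq_single τ]
    · simp [hcτ]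
    · intro τ' _ hne
      rw [if_neg]
      intro h'
      exact hne (hc _ _ _ h' hcτ)
    · intro h'; exact absurd hτ h'
  · rw [Finset.sum_eq_zero]
    · simp
    · intro τ hτ
      rw [if_neg]
      intro h'; exact hb ⟨τ, hτ, h'⟩

theorem div_core {σ : Type*} [DecidableEq σ] (w : (σ →₀ ℕ) → ℕ) (hwi : Function.Injective w)
    (hwm : ∀ a b, w (a + b) = w a * w b) (hw0 : ∀ a, 0 < w a) (x : (σ →₀ ℕ) → ℝ≥0∞)
    (hx : ∀ a b, x (a + b) = x a * x b) (hxt : ∀ a, x a ≠ ⊤) (T : Finset (σ →₀ ℕ))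
    (c : (σ →₀ ℕ) → (σ →₀ ℕ) → Prop) [∀ a b, Decidable (c a b)]
    (hc : ∀ α τ τ', c α τ → c α τ' → τ = τ')
    (G : (σ →₀ ℕ) → MvPowerSeries σ ℂ)
    (hG : ∀ τ ∈ T, ∀ δ, MvPowerSeries.coeff δ (G τ) ≠ 0 → w τ < w δ)
    (hGn : ∀ τ ∈ T, wN x (G τ) ≤ x τ * 2⁻¹)
    (h : MvPowerSeries σ ℂ) (hh : wN x h ≠ ⊤) :
    ∃ u : MvPowerSeries σ ℂ, wN x u ≠ ⊤ ∧ h = u + ∑ τ ∈ T, Qop c τ u * G τ := by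
  let u : MvPowerSeries σ ℂ := uRec w T c G h
  have hu : ∀ α, MvPowerSeries.coeff α u = uRec w T c G h α := fun _ => rfl
  -- strictness
  have hlt : ∀ τ ∈ T, ∀ α, ∀ p ∈ Finset.HasAntidiagonal.antidiagonal α,
      MvPowerSeries.coeff p.2 (G τ) ≠ 0 → w (p.1 + τ) < w α := by
    intro τ hτ α p hp hne
    rw [Finset.HasAntidiagonal.mem_antidiagonal] at hp
    rw [← hp, hwm, hwm]
    exact Nat.mul_lt_mul_of_pos_left (hG τ hτ _ hne) (hw0 _)
  have heq : h = u + ∑ τ ∈ T, Qop c τ u * G τ := by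
    ext α
    rw [map_add, hu, uRec, map_sum]
    rw [eq_comm, sub_add, sub_eq_self, sub_eq_zero]
    refine Finset.sum_congr rfl fun τ hτ => ?_
    rw [MvPowerSeries.coeff_mul]
    refine Finset.sum_congr rfl fun p hp => ?_
    split_ifs with h1 h2
    · rw [coeff_Qop, if_pos h2, hu]
    · rw [coeff_Qop, if_neg h2]
    · by_cases h3 : MvPowerSeries.coeff p.2 (G τ) = 0
      · rw [h3, mul_zero]
      · exact absurd (hlt τ hτ α p hp h3) h1
  refine ⟨u, ?_, heq⟩
  -- truncations
  let um : ℕ → MvPowerSeries σ ℂ := fun m α => if w α < m then MvPowerSeries.coeff α u else 0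
  have hum : ∀ m α, MvPowerSeries.coeff α (um m) =
    if w α < m then MvPowerSeries.coeff α u else 0 := fun _ _ => rfl
  have hbound : ∀ m, wN x (um m) ≤ 2 * wN x h := by
    intro m
    have hfin : wN x (um m) ≠ ⊤ := by
      have hf : {α | w α < m}.Finite := (Set.finite_lt_nat m).preimage hwi.injOn
      refine wN_finite x hxt _ hf.toFinset fun α hα => ?_
      rw [hum, if_neg]
      simpa using hα
    have h1 : wN x (um m) ≤ wN x (h - ∑ τ ∈ T, Qop c τ (um m) * G τ) := by
      refine wN_mono _ _ _ fun α => ?_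
      rw [hum]
      split_ifs with hα
      · refine le_of_eq ?_
        congr 1
        have : MvPowerSeries.coeff α u =
            MvPowerSeries.coeff α (h - ∑ τ ∈ T, Qop c τ u * G τ) := by
          conv_rhs => rw [heq]
          simp
        rw [this, map_sub, map_sub, map_sum, map_sum]
        congr 1
        refine Finset.sum_congr rfl fun τ hτ => ?_
        rw [MvPowerSeries.coeff_mul, MvPowerSeries.coeff_mul]
        refine Finset.sum_congr rfl fun p hp => ?_
        by_cases h3 : MvPowerSeries.coeff p.2 (G τ) = 0
        · rw [h3, mul_zero, mul_zero]
        · rw [coeff_Qop, coeff_Qop, hum, if_pos ((hlt τ hτ α p hp h3).trans hα)]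
      · simp
    have h2 : wN x (h - ∑ τ ∈ T, Qop c τ (um m) * G τ) ≤ wN x h + wN x (um m) * 2⁻¹ := by
      rw [sub_eq_add_neg]
      refine (wN_add _ _ _).trans (add_le_add le_rfl ?_)
      rw [wN_neg]
      refine (wN_sum _ _ _).trans ?_
      calc _ ≤ ∑ τ ∈ T, (wN x (Qop c τ (um m)) * x τ) * 2⁻¹ := by
            refine Finset.sum_le_sum fun τ hτ => ?_
            refine (wN_mul x hx _ _).trans ?_
            rw [mul_assoc]
            exact mul_le_mul_right (hGn τ hτ) _
        _ ≤ _ := by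
            rw [← Finset.sum_mul]
            exact mul_le_mul_left (Qop_norm x hx T c hc _) _
    have h3 := h1.trans h2
    have h4 : wN x (um m) * 2⁻¹ ≠ ⊤ := ENNReal.mul_ne_top hfin (by simp)
    have h5 : wN x (um m) = wN x (um m) * 2⁻¹ + wN x (um m) * 2⁻¹ := by
      rw [← mul_add, ENNReal.inv_two_add_inv_two, mul_one]
    have h6 : wN x (um m) * 2⁻¹ ≤ wN x h := by
      have : wN x (um m) * 2⁻¹ + wN x (um m) * 2⁻¹ ≤ wN x h + wN x (um m) * 2⁻¹ := by
        rw [← h5]; exact h3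
      exact (ENNReal.add_le_add_iff_right h4).1 this
    rw [h5, two_mul]
    exact add_le_add h6 h6
  have : wN x u ≤ 2 * wN x h := by
    unfold wN
    rw [ENNReal.tsum_eq_iSup_sum]
    refine iSup_le fun s => ?_
    refine le_trans ?_ (hbound (s.sup w + 1))
    refine le_trans (le_of_eq ?_) (ENNReal.sum_le_tsum s)
    refine Finset.sum_congr rfl fun α hα => ?_
    rw [hum, if_pos (Nat.lt_succ_of_le (Finset.le_sup hα))]
  exact ne_top_of_le_ne_top (ENNReal.mul_ne_top (by simp) hh) this

theorem exists_weight (n : ℕ) : ∃ (w : (Fin n →₀ ℕ) → ℕ) (P : ℕ), Function.Injective w ∧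
    (∀ a b, w (a + b) = w a * w b) ∧ (∀ a, 2 ^ (Finsupp.degree a) ≤ w a) ∧
    (∀ a, w a ≤ P ^ (Finsupp.degree a)) := by
  let pr : Fin n → ℕ := fun i => Nat.nth Nat.Prime i
  have hpr : ∀ i, (pr i).Prime := fun i => Nat.prime_nth_prime i
  have hinj : Function.Injective pr := by
    intro i j hij
    exact Fin.ext (Nat.nth_injective Nat.infinite_setOfPred_prime hij)
  refine ⟨fun a => ∏ i, pr i ^ a i, Finset.univ.sup pr, ?_, ?_, ?_, ?_⟩
  · intro a b hab
    have key : ∀ (c : Fin n →₀ ℕ) (j : Fin n), (∏ i, pr i ^ c i).factorization (pr j) = c j := by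
      intro c j
      rw [Nat.factorization_prod (fun i _ => pow_ne_zero _ (hpr i).ne_zero)]
      rw [Finset.sum_apply']
      rw [Finset.sum_eq_single j]
      · simp [(hpr j).factorization_self]
      · intro i _ hij
        rw [(hpr i).factorization_pow]
        exact Finsupp.single_eq_of_ne (fun h => hij (hinj h.symm))
      · simp
    ext j
    have h1 := key a j
    have h2 := key b j
    simp only at hab
    rw [← h1, ← h2, hab]
  · intro a b
    simp [pow_add, Finset.prod_mul_distrib]
  · intro a
    simp only [Finsupp.degree_eq_sum]
    rw [← Finset.prod_pow_eq_pow_sum]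
    exact Finset.prod_le_prod' fun i _ => Nat.pow_le_pow_left (hpr i).two_le _
  · intro a
    simp only [Finsupp.degree_eq_sum]
    rw [← Finset.prod_pow_eq_pow_sum]
    exact Finset.prod_le_prod' fun i _ => Nat.pow_le_pow_left (Finset.le_sup (Finset.mem_univ i)) _

/-- uniform polydisc weight -/
noncomputable def rwt (n : ℕ) (ρ : ℝ≥0) (α : Fin n →₀ ℕ) : ℝ≥0∞ := (ρ : ℝ≥0∞) ^ (Finsupp.degree α)

theorem rwt_add (n : ℕ) (ρ : ℝ≥0) (a b : Fin n →₀ ℕ) : rwt n ρ (a + b) = rwt n ρ a * rwt n ρ b := by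
  simp [rwt, pow_add]

theorem rwt_ne_top (n : ℕ) (ρ : ℝ≥0) (a : Fin n →₀ ℕ) : rwt n ρ a ≠ ⊤ := by
  simp [rwt]

theorem rwt_mono (n : ℕ) {ρ ρ' : ℝ≥0} (h : ρ ≤ ρ') (a : Fin n →₀ ℕ) : rwt n ρ a ≤ rwt n ρ' a := by
  unfold rwt; gcongr

theorem wN_C_ne_top {σ : Type*} (x : (σ →₀ ℕ) → ℝ≥0∞) (hx : ∀ a, x a ≠ ⊤)
    (p : MvPolynomial σ ℂ) : wN x (p : MvPowerSeries σ ℂ) ≠ ⊤ := by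
  refine wN_finite x hx _ p.support fun α hα => ?_
  rw [MvPolynomial.coeff_coe]
  simpa using hα

/-- power series converging absolutely on the closed polydisc of radius `ρ` -/
noncomputable def Oρ (n : ℕ) (ρ : ℝ≥0) : Subring (MvPowerSeries (Fin n) ℂ) where
  carrier := {f | wN (rwt n ρ) f ≠ ⊤}
  zero_mem' := by simp [wN_zero]
  one_mem' := by
    have := wN_C_ne_top (rwt n ρ) (rwt_ne_top n ρ) 1
    simpa using this
  add_mem' := fun {a b} ha hb =>
    ne_top_of_le_ne_top (ENNReal.add_ne_top.2 ⟨ha, hb⟩) (wN_add _ _ _)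
  mul_mem' := fun {a b} ha hb =>
    ne_top_of_le_ne_top (ENNReal.mul_ne_top ha hb) (wN_mul _ (rwt_add n ρ) _ _)
  neg_mem' := fun {a} ha => by simpa [wN_neg] using ha

theorem mem_Oρ {n : ℕ} {ρ : ℝ≥0} {f : MvPowerSeries (Fin n) ℂ} :
    f ∈ Oρ n ρ ↔ wN (rwt n ρ) f ≠ ⊤ := Iff.rfl

theorem Oρ_mono {n : ℕ} {ρ ρ' : ℝ≥0} (h : ρ ≤ ρ') {f : MvPowerSeries (Fin n) ℂ}
    (hf : f ∈ Oρ n ρ') : f ∈ Oρ n ρ :=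
  ne_top_of_le_ne_top hf (wN_mono' _ _ _ (rwt_mono n h))

/-- convergent power series -/
noncomputable def Ocv (n : ℕ) : Subring (MvPowerSeries (Fin n) ℂ) where
  carrier := {f | ∃ ρ : ℝ≥0, 0 < ρ ∧ f ∈ Oρ n ρ}
  zero_mem' := ⟨1, one_pos, zero_mem _⟩
  one_mem' := ⟨1, one_pos, one_mem _⟩
  add_mem' := by
    rintro a b ⟨ρ, h, ha⟩ ⟨ρ', h', hb⟩
    exact ⟨min ρ ρ', lt_min h h', add_mem (Oρ_mono (min_le_left _ _) ha)
      (Oρ_mono (min_le_right _ _) hb)⟩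
  mul_mem' := by
    rintro a b ⟨ρ, h, ha⟩ ⟨ρ', h', hb⟩
    exact ⟨min ρ ρ', lt_min h h', mul_mem (Oρ_mono (min_le_left _ _) ha)
      (Oρ_mono (min_le_right _ _) hb)⟩
  neg_mem' := by
    rintro a ⟨ρ, h, ha⟩
    exact ⟨ρ, h, neg_mem ha⟩

theorem mem_Ocv {n : ℕ} {f : MvPowerSeries (Fin n) ℂ} :
    f ∈ Ocv n ↔ ∃ ρ : ℝ≥0, 0 < ρ ∧ f ∈ Oρ n ρ := Iff.rfl

theorem poly_mem_Oρ {n : ℕ} (ρ : ℝ≥0) (p : MvPolynomial (Fin n) ℂ) :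
    (p : MvPowerSeries (Fin n) ℂ) ∈ Oρ n ρ := wN_C_ne_top _ (rwt_ne_top n ρ) p

theorem poly_mem_Ocv {n : ℕ} (p : MvPolynomial (Fin n) ℂ) :
    (p : MvPowerSeries (Fin n) ℂ) ∈ Ocv n := ⟨1, one_pos, poly_mem_Oρ 1 p⟩

/-- weights attached to `w` -/
noncomputable def xs {n : ℕ} (w : (Fin n →₀ ℕ) → ℕ) (s : ℕ) (α : Fin n →₀ ℕ) : ℝ≥0∞ :=
  ((w α : ℝ≥0∞)⁻¹) ^ s

section xs
variable {n : ℕ} {w : (Fin n →₀ ℕ) → ℕ} 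

theorem xs_add (hwm : ∀ a b, w (a + b) = w a * w b) (hw0 : ∀ a, 0 < w a) (s : ℕ)
    (a b : Fin n →₀ ℕ) : xs w s (a + b) = xs w s a * xs w s b := by
  unfold xs
  rw [hwm, Nat.cast_mul, ENNReal.mul_inv, mul_pow]
  · right; simp
  · left; simp

theorem xs_ne_top (hw0 : ∀ a, 0 < w a) (s : ℕ) (a : Fin n →₀ ℕ) : xs w s a ≠ ⊤ := by
  unfold xs
  refine ENNReal.pow_ne_top ?_
  simp [(hw0 a).ne']

theorem xs_anti (hw0 : ∀ a, 0 < w a) {s t : ℕ} (h : s ≤ t) (a : Fin n →₀ ℕ) :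
    xs w t a ≤ xs w s a := by
  unfold xs
  refine pow_le_pow_right_of_le_one' ?_ h
  rw [ENNReal.inv_le_one]
  exact_mod_cast hw0 a

theorem mem_Ocv_of_xs {P : ℕ} (hw0 : ∀ a, 0 < w a) (hP : ∀ a, w a ≤ P ^ (Finsupp.degree a)) (s : ℕ)
    (f : MvPowerSeries (Fin n) ℂ) (hf : wN (xs w s) f ≠ ⊤) : f ∈ Ocv n := by
  refine ⟨(((P + 1 : ℕ) : ℝ≥0)⁻¹) ^ s, by positivity, ?_⟩
  refine ne_top_of_le_ne_top hf (wN_mono' _ _ _ fun α => ?_)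
  unfold rwt xs
  push_cast
  rw [← pow_mul, mul_comm, pow_mul]
  refine pow_le_pow_left' ?_ _
  rw [ENNReal.coe_inv (by positivity), ← ENNReal.inv_pow, ENNReal.inv_le_inv]
  push_cast
  have : (w α) ≤ (P + 1) ^ (Finsupp.degree α) :=
    (hP α).trans (Nat.pow_le_pow_left (Nat.le_succ P) _)
  exact_mod_cast this

theorem exists_xs_of_mem_Ocv (h2 : ∀ a, 2 ^ (Finsupp.degree a) ≤ w a)
    (f : MvPowerSeries (Fin n) ℂ) (hf : f ∈ Ocv n) : ∃ s, wN (xs w s) f ≠ ⊤ := by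
  obtain ⟨ρ, hρ, hf⟩ := hf
  obtain ⟨s, hs⟩ : ∃ s : ℕ, ((2 : ℝ≥0∞)⁻¹) ^ s < (ρ : ℝ≥0∞) := by
    refine ENNReal.exists_inv_two_pow_lt ?_
    simpa using hρ.ne'
  refine ⟨s, ne_top_of_le_ne_top hf (wN_mono' _ _ _ fun α => ?_)⟩
  unfold rwt xs
  calc _ ≤ (((2 : ℝ≥0∞) ^ (Finsupp.degree α))⁻¹) ^ s := by
        refine pow_le_pow_left' ?_ _
        rw [ENNReal.inv_le_inv]
        exact_mod_cast h2 α
    _ = (((2 : ℝ≥0∞)⁻¹) ^ s) ^ (Finsupp.degree α) := by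
        rw [ENNReal.inv_pow, ← pow_mul, ← pow_mul, mul_comm]
    _ ≤ _ := pow_le_pow_left' hs.le _

theorem tail_small (hw0 : ∀ a, 0 < w a) (G : MvPowerSeries (Fin n) ℂ) (τ : Fin n →₀ ℕ)
    (hG : ∀ δ, MvPowerSeries.coeff δ G ≠ 0 → w τ < w δ) (s₀ : ℕ) (hs : wN (xs w s₀) G ≠ ⊤) :
    ∃ s₁, ∀ s, s₁ ≤ s → wN (xs w s) G ≤ xs w s τ * 2⁻¹ := by
  -- write `s = s₀ + k`
  have h1 : ∀ k, wN (xs w (s₀ + k)) G ≤ wN (xs w s₀) G * (((w τ + 1 : ℕ) : ℝ≥0∞)⁻¹) ^ k := by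
    intro k
    unfold wN
    rw [← ENNReal.tsum_mul_right]
    refine ENNReal.tsum_le_tsum fun α => ?_
    by_cases h : MvPowerSeries.coeff α G = 0
    · simp [h]
    · rw [mul_assoc]
      refine mul_le_mul_right ?_ _
      unfold xs
      rw [pow_add]
      refine mul_le_mul_right (pow_le_pow_left' ?_ _) _
      rw [ENNReal.inv_le_inv]
      exact_mod_cast hG α h
  set A := wN (xs w s₀) G
  set m : ℝ≥0∞ := (w τ : ℝ≥0∞) with hm
  have hm0 : m ≠ 0 := by simpa [hm] using (hw0 τ).ne'
  have hmt : m ≠ ⊤ := by simp [hm]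
  have hlt : m / ((w τ + 1 : ℕ) : ℝ≥0∞) < 1 := by
    rw [ENNReal.div_lt_iff (by simp) (by simp), one_mul, hm]
    exact_mod_cast Nat.lt_succ_self _
  have htend : Filter.Tendsto (fun k : ℕ => A * (m / ((w τ + 1 : ℕ) : ℝ≥0∞)) ^ k) Filter.atTop
      (nhds 0) := by
    have := ENNReal.Tendsto.const_mul (ENNReal.tendsto_pow_atTop_nhds_zero_of_lt_one hlt)
      (Or.inr hs : (0 : ℝ≥0∞) ≠ 0 ∨ A ≠ ⊤)
    simpa using this
  have hpos : (0 : ℝ≥0∞) < (m⁻¹) ^ s₀ * 2⁻¹ := by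
    refine ENNReal.mul_pos (pow_ne_zero _ (by simpa using hmt)) (by simp)
  obtain ⟨k₁, hk⟩ := Filter.eventually_atTop.1 (htend.eventually (gt_mem_nhds hpos))
  refine ⟨s₀ + k₁, fun s hsge => ?_⟩
  obtain ⟨k, rfl⟩ : ∃ k, s = s₀ + k := ⟨s - s₀, by omega⟩
  have h2 := (hk k (by omega)).le
  refine (h1 k).trans ?_
  unfold xs
  rw [← hm, pow_add]
  have h3 : m ^ k * (m⁻¹) ^ k = 1 := by
    rw [← mul_pow, ENNReal.mul_inv_cancel hm0 hmt, one_pow]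
  calc A * (((w τ + 1 : ℕ) : ℝ≥0∞)⁻¹) ^ k
      = (A * (m / ((w τ + 1 : ℕ) : ℝ≥0∞)) ^ k) * (m⁻¹) ^ k := by
        rw [div_eq_mul_inv, mul_pow, mul_assoc, mul_right_comm (m ^ k), h3, one_mul]
    _ ≤ ((m⁻¹) ^ s₀ * 2⁻¹) * (m⁻¹) ^ k := mul_le_mul_left h2 _
    _ = _ := by ring
end xs

theorem ideal_closed {n : ℕ} (I : Ideal (Ocv n)) (h : Ocv n)
    (hyp : ∀ N : ℕ, ∃ g ∈ I, ∀ α, Finsupp.degree α < N →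
      MvPowerSeries.coeff α g.1 = MvPowerSeries.coeff α h.1) : h ∈ I := by
  classical
  obtain ⟨w, P, hwi, hwm, h2, hP⟩ := exists_weight n
  have hw0 : ∀ a, 0 < w a := fun a => lt_of_lt_of_le (by positivity) (h2 a)
  let L : Set (Fin n →₀ ℕ) := {α | ∃ g ∈ I, MvPowerSeries.coeff α g.1 = 1 ∧
    ∀ β, w β < w α → MvPowerSeries.coeff β g.1 = 0}
  let T₀ : Set (Fin n →₀ ℕ) := {α | Minimal (· ∈ L) α}
  have hT₀ : T₀.Finite := WellQuasiOrderedLE.finite_of_isAntichain (setOfPred_minimal_antichain _)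
  have hex : ∀ α ∈ L, ∃ τ, τ ≤ α ∧ Minimal (· ∈ L) τ := fun α hα =>
    exists_minimal_le_of_wellFoundedLT (· ∈ L) α hα
  choose! t ht1 ht2 using hex
  let T : Finset (Fin n →₀ ℕ) := hT₀.toFinset
  have hT : ∀ τ, τ ∈ T ↔ Minimal (· ∈ L) τ := fun τ => by simp [T, T₀]
  let c : (Fin n →₀ ℕ) → (Fin n →₀ ℕ) → Prop := fun α τ => α ∈ L ∧ t α = τ
  have hc : ∀ α τ τ', c α τ → c α τ' → τ = τ' := fun α τ τ' h1 h2 => h1.2.symm.trans h2.2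
  have hg : ∀ τ ∈ T, ∃ g ∈ I, MvPowerSeries.coeff τ g.1 = 1 ∧
    ∀ β, w β < w τ → MvPowerSeries.coeff β g.1 = 0 := fun τ hτ => ((hT τ).1 hτ).1
  choose! g hgI hg1 hg2 using hg
  let G : (Fin n →₀ ℕ) → MvPowerSeries (Fin n) ℂ := fun τ => (g τ).1 - MvPowerSeries.monomial τ 1
  have hmon : ∀ τ : Fin n →₀ ℕ, MvPowerSeries.monomial τ (1:ℂ) ∈ Ocv n := fun τ => by
    have := poly_mem_Ocv (n := n) (MvPolynomial.monomial τ 1)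
    rwa [MvPolynomial.coe_monomial] at this
  have hGO : ∀ τ, G τ ∈ Ocv n := fun τ => sub_mem (g τ).2 (hmon τ)
  have hG : ∀ τ ∈ T, ∀ δ, MvPowerSeries.coeff δ (G τ) ≠ 0 → w τ < w δ := by
    intro τ hτ δ hδ
    by_contra hlt
    apply hδ
    simp only [G, map_sub, MvPowerSeries.coeff_monomial]
    by_cases he : δ = τ
    · subst he; simp [hg1 δ hτ]
    · have : w δ < w τ := lt_of_le_of_ne (not_lt.1 hlt) (fun h => he (hwi h))
      simp [he, hg2 τ hτ δ this]
  have hs : ∀ τ ∈ T, ∃ s₁, ∀ s, s₁ ≤ s → wN (xs w s) (G τ) ≤ xs w s τ * 2⁻¹ := by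
    intro τ hτ
    obtain ⟨s₀, hs₀⟩ := exists_xs_of_mem_Ocv h2 (G τ) (hGO τ)
    exact tail_small hw0 (G τ) τ (hG τ hτ) s₀ hs₀
  choose! s₁ hs₁ using hs
  obtain ⟨sh, hsh⟩ := exists_xs_of_mem_Ocv h2 h.1 h.2
  let s : ℕ := max sh (T.sup s₁)
  have hhs : wN (xs w s) h.1 ≠ ⊤ :=
    ne_top_of_le_ne_top hsh (wN_mono' _ _ _ (xs_anti hw0 (le_max_left _ _)))
  obtain ⟨u, hu, hdiv⟩ := div_core w hwi hwm hw0 (xs w s) (xs_add hwm hw0 s) (xs_ne_top hw0 s) T c hc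
    G hG (fun τ hτ => hs₁ τ hτ s (le_trans (Finset.le_sup hτ) (le_max_right _ _))) h.1 hhs
  have hQ : ∀ τ ∈ T, Qop c τ u ∈ Ocv n := by
    intro τ hτ
    refine mem_Ocv_of_xs hw0 hP s _ ?_
    intro htop
    have h1 := Qop_norm (xs w s) (xs_add hwm hw0 s) T c hc u
    have h3 := (Finset.single_le_sum (f := fun τ => wN (xs w s) (Qop c τ u) * xs w s τ)
      (fun _ _ => zero_le) hτ).trans h1
    simp only [htop] at h3
    rw [ENNReal.top_mul] at h3
    · exact hu (top_le_iff.1 h3)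
    · unfold xs; simp
  -- the remainder
  let q : (Fin n →₀ ℕ) → Ocv n := fun τ => if hτ : τ ∈ T then ⟨Qop c τ u, hQ τ hτ⟩ else 0
  have hq : ∀ τ ∈ T, (q τ).1 = Qop c τ u := fun τ hτ => by simp [q, hτ]
  let v : Ocv n := ∑ τ ∈ T, q τ * g τ
  have hvI : v ∈ I := sum_mem fun τ hτ => I.mul_mem_left _ (hgI τ hτ)
  let r : Ocv n := h - v
  have hv1 : v.1 = ∑ τ ∈ T, Qop c τ u * (g τ).1 := by
    simp only [v]
    rw [AddSubmonoidClass.coe_finsetSum]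
    refine Finset.sum_congr rfl fun τ hτ => ?_
    rw [← hq τ hτ]; rfl
  have hr : r.1 = u - ∑ τ ∈ T, Qop c τ u * MvPowerSeries.monomial τ 1 := by
    have : r.1 = h.1 - v.1 := rfl
    rw [this, hv1, hdiv, add_sub_assoc, ← Finset.sum_sub_distrib, sub_eq_add_neg, ← Finset.sum_neg_distrib]
    congr 1
    refine Finset.sum_congr rfl fun τ hτ => ?_
    simp only [G]; ring
  have hrL : ∀ α ∈ L, MvPowerSeries.coeff α r.1 = 0 := by
    intro α hα
    rw [hr, map_sub, map_sum, sub_eq_zero]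
    rw [Finset.sum_eq_single (t α)]
    · rw [MvPowerSeries.coeff_mul_monomial, if_pos (ht1 α hα), coeff_Qop, tsub_add_cancel_of_le (ht1 α hα),
        if_pos ⟨hα, rfl⟩, mul_one]
    · intro τ hτ hne
      rw [MvPowerSeries.coeff_mul_monomial]
      split_ifs with hle
      · rw [coeff_Qop, tsub_add_cancel_of_le hle, if_neg, zero_mul]
        exact fun hh => hne hh.2.symm
      · rfl
    · intro hn
      exact absurd ((hT _).2 (ht2 α hα)) hn
  have hr0 : r = 0 := by
    by_contra hne
    have hex : ∃ m, ∃ α, w α = m ∧ MvPowerSeries.coeff α r.1 ≠ 0 := by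
      by_contra hcon
      push Not at hcon
      apply hne
      apply Subtype.ext
      ext α
      simpa using hcon (w α) α rfl
    obtain ⟨α, hα, hαne⟩ := Nat.find_spec hex
    have hmin : ∀ β, w β < w α → MvPowerSeries.coeff β r.1 = 0 := by
      intro β hβ
      by_contra hb
      rw [hα] at hβ
      exact Nat.find_min hex hβ ⟨β, rfl, hb⟩
    obtain ⟨g', hg'I, hg'⟩ := hyp (w α + 1)
    have hco : ∀ β, w β ≤ w α → MvPowerSeries.coeff β (g' - v).1 = MvPowerSeries.coeff β r.1 := by
      intro β hβ
      have h3 : Finsupp.degree β < w α + 1 :=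
        Nat.lt_succ_of_le ((Nat.lt_two_pow_self.le.trans (h2 β)).trans hβ)
      have e1 : (g' - v).1 = g'.1 - v.1 := rfl
      have e2 : r.1 = h.1 - v.1 := rfl
      rw [e1, e2, map_sub, map_sub, hg' β h3]
    let k : Ocv n := ⟨MvPowerSeries.C (MvPowerSeries.coeff α r.1)⁻¹, by
      have := poly_mem_Ocv (n := n) (MvPolynomial.C (MvPowerSeries.coeff α r.1)⁻¹)
      rwa [MvPolynomial.coe_C] at this⟩
    have hαL : α ∈ L := by
      refine ⟨k * (g' - v), I.mul_mem_left _ (I.sub_mem hg'I hvI), ?_, ?_⟩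
      · have e1 : (k * (g' - v)).1 = MvPowerSeries.C (MvPowerSeries.coeff α r.1)⁻¹ * (g' - v).1 := rfl
        rw [e1, MvPowerSeries.coeff_C_mul, hco α le_rfl, inv_mul_cancel₀ hαne]
      · intro β hβ
        have e1 : (k * (g' - v)).1 = MvPowerSeries.C (MvPowerSeries.coeff α r.1)⁻¹ * (g' - v).1 := rfl
        rw [e1, MvPowerSeries.coeff_C_mul, hco β hβ.le, hmin β hβ, mul_zero]
    exact hαne (hrL α hαL)
  have : h = v := sub_eq_zero.1 hr0
  rw [this]; exact hvI

theorem formal_thm {n : ℕ} (F : Fin n → MvPowerSeries (Fin n) ℂ) (hF : ∀ i, F i ∈ Ocv n)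
    (hD : ∀ i j, MvPowerSeries.pderiv ℂ j (F i) ∈ Ocv n) (H : MvPowerSeries (Fin n) ℂ)
    (hH : H ∈ Ocv n) (h0 : MvPowerSeries.constantCoeff H = 0) :
    ∃ a : Fin n → MvPowerSeries (Fin n) ℂ, (∀ i, a i ∈ Ocv n) ∧
      H * Matrix.det (Matrix.of fun i j => MvPowerSeries.pderiv ℂ j (F i)) = ∑ i, a i * F i := by
  let F' : Fin n → Ocv n := fun i => ⟨F i, hF i⟩
  let M : Matrix (Fin n) (Fin n) (Ocv n) := Matrix.of fun i j => ⟨MvPowerSeries.pderiv ℂ j (F i), hD i j⟩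
  have hdet : (M.det : MvPowerSeries (Fin n) ℂ) =
      Matrix.det (Matrix.of fun i j => MvPowerSeries.pderiv ℂ j (F i)) := by
    have := (Ocv n).subtype.map_det M
    exact this
  let h : Ocv n := ⟨H, hH⟩ * M.det
  have hh1 : h.1 = H * Matrix.det (Matrix.of fun i j => MvPowerSeries.pderiv ℂ j (F i)) := by
    rw [← hdet]; rfl
  have key : h ∈ Ideal.span (Set.range F') := by
    apply ideal_closed
    intro N
    obtain ⟨a, ha⟩ := jac_trunc F H h0 N
    refine ⟨∑ i, ⟨(a i : MvPowerSeries (Fin n) ℂ), poly_mem_Ocv (a i)⟩ * F' i,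
      sum_mem fun i _ => Ideal.mul_mem_left _ _ (Ideal.subset_span ⟨i, rfl⟩), fun α hα => ?_⟩
    rw [hh1, ha α hα, AddSubmonoidClass.coe_finsetSum]
    rfl
  obtain ⟨a, ha⟩ := (Ideal.mem_span_range_iff_exists_fun).1 key
  refine ⟨fun i => (a i).1, fun i => (a i).2, ?_⟩
  rw [← hh1, ← ha, AddSubmonoidClass.coe_finsetSum]
  rfl

/-- monomials -/
noncomputable def mono {n : ℕ} (z : Fin n → ℂ) (α : Fin n →₀ ℕ) : ℂ := ∏ i, z i ^ α i

theorem mono_add {n : ℕ} (z : Fin n → ℂ) (α β : Fin n →₀ ℕ) :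
    mono z (α + β) = mono z α * mono z β := by
  simp [mono, pow_add, Finset.prod_mul_distrib]

theorem mono_zero {n : ℕ} (z : Fin n → ℂ) : mono z 0 = 1 := by
  simp [mono]

theorem mono_single {n : ℕ} (z : Fin n → ℂ) (j : Fin n) : mono z (Finsupp.single j 1) = z j := by
  classical
  unfold mono
  rw [Finset.prod_eq_single j]
  · simp
  · intro i _ hi
    simp [hi.symm]
  · simp

theorem mono_sum {n : ℕ} (z : Fin n → ℂ) {ι : Type*} (s : Finset ι) (g : ι → (Fin n →₀ ℕ)) :
    mono z (∑ l ∈ s, g l) = ∏ l ∈ s, mono z (g l) := by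
  classical
  induction s using Finset.induction_on with
  | empty => simp [mono_zero]
  | insert a s ha ih => rw [Finset.sum_insert ha, Finset.prod_insert ha, mono_add, ih]

theorem mono_norm {n : ℕ} (z : Fin n → ℂ) (α : Fin n →₀ ℕ) : ‖mono z α‖ ≤ ‖z‖ ^ Finsupp.degree α := by
  unfold mono
  rw [norm_prod, Finsupp.degree_eq_sum, ← Finset.prod_pow_eq_pow_sum]
  refine Finset.prod_le_prod (fun _ _ => norm_nonneg _) fun i _ => ?_
  rw [norm_pow]
  exact pow_le_pow_left₀ (norm_nonneg _) (norm_le_pi_norm z i) _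

theorem mono_enorm {n : ℕ} {ρ : ℝ≥0} (z : Fin n → ℂ) (hz : ‖z‖ ≤ ρ) (α : Fin n →₀ ℕ) :
    ‖mono z α‖ₑ ≤ rwt n ρ α := by
  have h1 : ‖mono z α‖₊ ≤ ρ ^ Finsupp.degree α := by
    rw [← NNReal.coe_le_coe, coe_nnnorm, NNReal.coe_pow]
    exact (mono_norm z α).trans (pow_le_pow_left₀ (norm_nonneg _) hz _)
  unfold rwt
  rw [enorm_eq_nnnorm]
  exact_mod_cast h1

/-- evaluation -/
noncomputable def ev {n : ℕ} (f : MvPowerSeries (Fin n) ℂ) (z : Fin n → ℂ) : ℂ :=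
  ∑' α, MvPowerSeries.coeff α f * mono z α

theorem ev_summable {n : ℕ} {ρ : ℝ≥0} {f : MvPowerSeries (Fin n) ℂ} (hf : f ∈ Oρ n ρ)
    (z : Fin n → ℂ) (hz : ‖z‖ ≤ ρ) :
    Summable fun α => ‖MvPowerSeries.coeff α f * mono z α‖ := by
  rw [← tsum_enorm_ne_top_iff_summable_norm]
  refine ne_top_of_le_ne_top hf (ENNReal.tsum_le_tsum fun α => ?_)
  rw [enorm_mul]
  gcongr
  exact mono_enorm z hz α

theorem ev_add {n : ℕ} {ρ : ℝ≥0} {f g : MvPowerSeries (Fin n) ℂ} (hf : f ∈ Oρ n ρ) (hg : g ∈ Oρ n ρ)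
    (z : Fin n → ℂ) (hz : ‖z‖ ≤ ρ) : ev (f + g) z = ev f z + ev g z := by
  unfold ev
  rw [← (ev_summable hf z hz).of_norm.tsum_add (ev_summable hg z hz).of_norm]
  simp [add_mul]

theorem ev_mul {n : ℕ} {ρ : ℝ≥0} {f g : MvPowerSeries (Fin n) ℂ} (hf : f ∈ Oρ n ρ) (hg : g ∈ Oρ n ρ)
    (z : Fin n → ℂ) (hz : ‖z‖ ≤ ρ) : ev (f * g) z = ev f z * ev g z := by
  classical
  have h1 := ev_summable hf z hz
  have h2 := ev_summable hg z hz
  have h3 : Summable fun x : (Fin n →₀ ℕ) × (Fin n →₀ ℕ) =>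
      (MvPowerSeries.coeff x.1 f * mono z x.1) * (MvPowerSeries.coeff x.2 g * mono z x.2) :=
    summable_mul_of_summable_norm (f := fun α => MvPowerSeries.coeff α f * mono z α)
      (g := fun α => MvPowerSeries.coeff α g * mono z α) h1 h2
  have key := Summable.tsum_mul_tsum_eq_tsum_sum_antidiagonal
    (f := fun α => MvPowerSeries.coeff α f * mono z α)
    (g := fun α => MvPowerSeries.coeff α g * mono z α) h1.of_norm h2.of_norm h3
  unfold ev
  rw [key]
  refine tsum_congr fun α => ?_
  rw [MvPowerSeries.coeff_mul, Finset.sum_mul]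
  refine Finset.sum_congr rfl fun p hp => ?_
  rw [Finset.HasAntidiagonal.mem_antidiagonal] at hp
  rw [← hp, mono_add]; ring

theorem ev_at_zero {n : ℕ} (f : MvPowerSeries (Fin n) ℂ) : ev f 0 = MvPowerSeries.constantCoeff f := by
  unfold ev
  rw [tsum_eq_single 0]
  · simp [mono_zero]
  · intro α hα
    obtain ⟨i, hi⟩ : ∃ i, α i ≠ 0 := by
      by_contra hcon; push Not at hcon; exact hα (Finsupp.ext hcon)
    have : mono (0 : Fin n → ℂ) α = 0 := by
      unfold mono
      exact Finset.prod_eq_zero (Finset.mem_univ i) (by simp [hi])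
    rw [this, mul_zero]

theorem ev_one {n : ℕ} (z : Fin n → ℂ) : ev (1 : MvPowerSeries (Fin n) ℂ) z = 1 := by
  classical
  unfold ev
  rw [tsum_eq_single 0]
  · simp [mono_zero]
  · intro α hα
    simp [MvPowerSeries.coeff_one, hα]

/-- evaluation as a ring homomorphism -/
noncomputable def evHom {n : ℕ} (ρ : ℝ≥0) (z : Fin n → ℂ) (hz : ‖z‖ ≤ ρ) : Oρ n ρ →+* ℂ where
  toFun f := ev f.1 z
  map_one' := ev_one z
  map_zero' := by simp [ev]
  map_add' f g := ev_add f.2 g.2 z hz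
  map_mul' f g := ev_mul f.2 g.2 z hz

theorem exists_mono_multilinear {n : ℕ} (α : Fin n →₀ ℕ) (k : ℕ) (hk : Finsupp.degree α = k) :
    ∃ M : ContinuousMultilinearMap ℂ (fun _ : Fin k => Fin n → ℂ) ℂ, ‖M‖ ≤ 1 ∧
      ∀ z, M (fun _ => z) = mono z α := by
  classical
  obtain ⟨v, hv⟩ : ∃ v : Fin k → Fin n, ∑ l, Finsupp.single (v l) 1 = α := by
    induction k generalizing α with
    | zero => 
      refine ⟨fun l => l.elim0, ?_⟩
      have : α = 0 := (Finsupp.degree_eq_zero_iff α).1 hk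
      simp [this]
    | succ k ih =>
      obtain ⟨i, hi⟩ : ∃ i, α i ≠ 0 := by
        by_contra hcon; push Not at hcon
        have : α = 0 := Finsupp.ext hcon
        simp [this] at hk
      have hle : Finsupp.single i 1 ≤ α := by
        rw [Finsupp.single_le_iff]; omega
      have h3 : (α - Finsupp.single i 1) + Finsupp.single i 1 = α := tsub_add_cancel_of_le hle
      obtain ⟨v, hv⟩ := ih (α - Finsupp.single i 1) (by
        have := congrArg Finsupp.degree h3
        simp only [map_add, Finsupp.degree_single] at this
        omega)
      refine ⟨Fin.cons i v, ?_⟩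
      rw [Fin.sum_univ_succ]
      simp only [Fin.cons_zero, Fin.cons_succ]
      rw [hv, add_comm, h3]
  refine ⟨(ContinuousMultilinearMap.mkPiAlgebra ℂ (Fin k) ℂ).compContinuousLinearMap
    (fun l => ContinuousLinearMap.proj (R := ℂ) (φ := fun _ : Fin n => ℂ) (v l)), ?_, ?_⟩
  · refine ContinuousMultilinearMap.opNorm_le_bound zero_le_one fun m => ?_
    simp only [ContinuousMultilinearMap.compContinuousLinearMap_apply,
      ContinuousMultilinearMap.mkPiAlgebra_apply, ContinuousLinearMap.proj_apply, one_mul]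
    rw [norm_prod]
    exact Finset.prod_le_prod (fun _ _ => norm_nonneg _) fun l _ => norm_le_pi_norm (m l) (v l)
  · intro z
    simp only [ContinuousMultilinearMap.compContinuousLinearMap_apply,
      ContinuousMultilinearMap.mkPiAlgebra_apply, ContinuousLinearMap.proj_apply]
    rw [← hv, mono_sum]
    simp [mono_single]

theorem ev_analytic {n : ℕ} {ρ : ℝ≥0} (hρ : 0 < ρ) {f : MvPowerSeries (Fin n) ℂ} (hf : f ∈ Oρ n ρ) :
    AnalyticOnNhd ℂ (ev f) (Metric.ball 0 ρ) := by
  classical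
  have hM : ∀ (k : ℕ) (α : Fin n →₀ ℕ), ∃ M : ContinuousMultilinearMap ℂ (fun _ : Fin k => Fin n → ℂ) ℂ,
      Finsupp.degree α = k → ‖M‖ ≤ 1 ∧ ∀ z, M (fun _ => z) = mono z α := by
    intro k α
    by_cases hk : Finsupp.degree α = k
    · obtain ⟨M, h⟩ := exists_mono_multilinear α k hk
      exact ⟨M, fun _ => h⟩
    · exact ⟨0, fun h => absurd h hk⟩
  choose M hM using hM
  let S : ℕ → Finset (Fin n →₀ ℕ) := fun k => Finset.finsuppAntidiag Finset.univ k
  have hS : ∀ k α, α ∈ S k ↔ Finsupp.degree α = k := by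
    intro k α
    simp [S, Finset.mem_finsuppAntidiag, Finsupp.degree_eq_sum]
  let p : FormalMultilinearSeries ℂ (Fin n → ℂ) ℂ := fun k => ∑ α ∈ S k, MvPowerSeries.coeff α f • M k α
  have hp : HasFPowerSeriesOnBall (ev f) p 0 ρ := by
    refine ⟨?_, by exact_mod_cast hρ, ?_⟩
    · refine p.le_radius_of_bound (wN (rwt n ρ) f).toReal fun k => ?_
      have h1 : ‖p k‖ ≤ ∑ α ∈ S k, ‖MvPowerSeries.coeff α f‖ := by
        refine (norm_sum_le _ _).trans (Finset.sum_le_sum fun α hα => ?_)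
        rw [norm_smul]
        exact mul_le_of_le_one_right (norm_nonneg _) (hM k α ((hS k α).1 hα)).1
      have h2 : ENNReal.ofReal ((∑ α ∈ S k, ‖MvPowerSeries.coeff α f‖) * (ρ:ℝ) ^ k) ≤ wN (rwt n ρ) f := by
        rw [Finset.sum_mul, ENNReal.ofReal_sum_of_nonneg (fun _ _ => by positivity)]
        refine le_trans (Finset.sum_le_sum fun α hα => ?_) (ENNReal.sum_le_tsum (S k))
        rw [ENNReal.ofReal_mul (norm_nonneg _), ofReal_norm, rwt, (hS k α).1 hα,
          ENNReal.ofReal_pow (NNReal.coe_nonneg _), ENNReal.ofReal_coe_nnreal]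
      calc ‖p k‖ * (ρ:ℝ) ^ k ≤ (∑ α ∈ S k, ‖MvPowerSeries.coeff α f‖) * (ρ:ℝ) ^ k := by gcongr
        _ ≤ _ := (ENNReal.ofReal_le_iff_le_toReal hf).1 h2
    · intro y hy
      have hy' : ‖y‖ ≤ ρ := by
        have : ‖y‖ < ρ := by simpa using hy
        exact this.le
      rw [zero_add]
      have h1 := (ev_summable hf y hy').of_norm.hasSum
      have h2 := h1.tsum_fiberwise (fun α => Finsupp.degree α)
      convert! h2 using 2 with k
      have h3 : (fun α : Fin n →₀ ℕ => Finsupp.degree α) ⁻¹' {k} = ↑(S k) := by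
        ext α; simp [hS]
      rw [h3]
      rw [Finset.tsum_subtype' (S k) (fun α => MvPowerSeries.coeff α f * mono y α)]
      simp only [p]
      rw [_root_.sum_apply]
      refine Finset.sum_congr rfl fun α hα => ?_
      rw [_root_.smul_apply, (hM k α ((hS k α).1 hα)).2 y, smul_eq_mul]
  intro z hz
  refine hp.analyticAt_of_mem ?_
  simpa using hz

theorem bern_aux (x δ : ℝ≥0) (k : ℕ) : ((k : ℝ≥0) + 1) * δ * x ^ k ≤ (x + δ) ^ (k + 1) := by
  induction k with
  | zero => simp
  | succ k ih =>
    have h1 : x ^ (k + 1) ≤ (x + δ) ^ (k + 1) := by gcongr; simp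
    calc ((↑(k + 1) : ℝ≥0) + 1) * δ * x ^ (k + 1)
        = x * (((k : ℝ≥0) + 1) * δ * x ^ k) + δ * x ^ (k + 1) := by push_cast; ring
      _ ≤ x * (x + δ) ^ (k + 1) + δ * (x + δ) ^ (k + 1) := by gcongr
      _ = (x + δ) ^ (k + 1 + 1) := by ring

theorem pderiv_mem {n : ℕ} {ρ' δ : ℝ≥0} (hδ : 0 < δ) {f : MvPowerSeries (Fin n) ℂ}
    (hf : f ∈ Oρ n (ρ' + δ)) (j : Fin n) : MvPowerSeries.pderiv ℂ j f ∈ Oρ n ρ' := by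
  have hf' : wN (rwt n (ρ' + δ)) f ≠ ⊤ := hf
  refine ne_top_of_le_ne_top (b := (δ : ℝ≥0∞)⁻¹ * wN (rwt n (ρ' + δ)) f)
    (ENNReal.mul_ne_top (by simpa using hδ.ne') hf') ?_
  unfold wN
  rw [← ENNReal.tsum_mul_left]
  refine le_trans ?_ (ENNReal.tsum_comp_le_tsum_of_injective
    (f := fun β : Fin n →₀ ℕ => β + Finsupp.single j 1) (fun a b h => add_right_cancel h) _)
  refine ENNReal.tsum_le_tsum fun β => ?_
  rw [MvPowerSeries.coeff_pderiv, enorm_mul]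
  have h1 : ‖((β j : ℂ) + 1)‖ₑ = ((β j + 1 : ℝ≥0) : ℝ≥0∞) := by
    rw [enorm_eq_nnnorm]
    congr 1
    have : ((β j : ℂ) + 1) = ((β j + 1 : ℕ) : ℂ) := by push_cast; ring
    rw [this]
    ext
    simp only [coe_nnnorm, Complex.norm_natCast]
    push_cast; ring
  have h2 : ((β j + 1 : ℝ≥0)) * ρ' ^ Finsupp.degree β ≤ δ⁻¹ * (ρ' + δ) ^ (Finsupp.degree β + 1) := by
    rw [← div_eq_inv_mul, le_div_iff₀ hδ]
    refine le_trans ?_ (bern_aux ρ' δ (Finsupp.degree β))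
    have : (β j : ℝ≥0) ≤ ((Finsupp.degree β : ℕ) : ℝ≥0) := by exact_mod_cast Finsupp.le_degree j β
    calc (β j + 1 : ℝ≥0) * ρ' ^ Finsupp.degree β * δ = (β j + 1 : ℝ≥0) * δ * ρ' ^ Finsupp.degree β := by ring
      _ ≤ _ := by gcongr
  have h3 : ((β j + 1 : ℝ≥0) : ℝ≥0∞) * rwt n ρ' β ≤
      (δ : ℝ≥0∞)⁻¹ * rwt n (ρ' + δ) (β + Finsupp.single j 1) := by
    unfold rwt
    rw [map_add, Finsupp.degree_single, ← ENNReal.coe_inv hδ.ne']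
    exact_mod_cast h2
  rw [h1, mul_assoc, mul_left_comm (δ : ℝ≥0∞)⁻¹]
  exact mul_le_mul_right h3 _

theorem mono_erase {n : ℕ} (w : Fin n → ℂ) (j : Fin n) (α : Fin n →₀ ℕ) :
    mono w α = w j ^ α j * ∏ i ∈ Finset.univ.erase j, w i ^ α i := by
  unfold mono
  rw [Finset.mul_prod_erase _ (fun i => w i ^ α i) (Finset.mem_univ j)]

theorem mono_deriv {n : ℕ} (z : Fin n → ℂ) (j : Fin n) (α : Fin n →₀ ℕ) (t : ℂ) :
    HasDerivAt (fun t : ℂ => mono (z + t • Pi.single j 1) α)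
      (α j * mono (z + t • Pi.single j 1) (α - Finsupp.single j 1)) t := by
  classical
  have h1 : ∀ (t : ℂ), ∀ i ∈ Finset.univ.erase j, (z + t • (Pi.single j 1 : Fin n → ℂ)) i = z i := by
    intro t i hi
    simp [Finset.ne_of_mem_erase hi]
  have h2 : ∀ t : ℂ, mono (z + t • Pi.single j 1) α =
      (z j + t) ^ α j * ∏ i ∈ Finset.univ.erase j, z i ^ α i := by
    intro t
    rw [mono_erase _ j]
    congr 1
    · simp
    · exact Finset.prod_congr rfl fun i hi => by rw [h1 t i hi]
  have h3 : mono (z + t • Pi.single j 1) (α - Finsupp.single j 1) =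
      (z j + t) ^ (α j - 1) * ∏ i ∈ Finset.univ.erase j, z i ^ α i := by
    rw [mono_erase _ j]
    congr 1
    · simp
    · refine Finset.prod_congr rfl fun i hi => ?_
      rw [h1 t i hi]
      simp [Finset.ne_of_mem_erase hi]
  rw [h3]
  simp_rw [h2]
  have h4 : HasDerivAt (fun t : ℂ => (z j + t) ^ α j) (α j * (z j + t) ^ (α j - 1)) t := by
    have h5 : HasDerivAt (fun t : ℂ => z j + t) 1 t := (hasDerivAt_id t).const_add (z j)
    have := h5.fun_pow (α j)
    rwa [mul_one] at this
  have := h4.mul_const (∏ i ∈ Finset.univ.erase j, z i ^ α i)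
  rwa [mul_assoc] at this

theorem ev_fderiv {n : ℕ} {ρ' δ : ℝ≥0} (hδ : 0 < δ) {f : MvPowerSeries (Fin n) ℂ}
    (hf : f ∈ Oρ n (ρ' + δ)) (j : Fin n) (z : Fin n → ℂ) (hz : ‖z‖ < ρ') :
    fderiv ℂ (ev f) z (Pi.single j 1) = ev (MvPowerSeries.pderiv ℂ j f) z := by
  classical
  have hline : ∀ t : ℂ, HasDerivAt (fun t : ℂ => z + t • (Pi.single j 1 : Fin n → ℂ)) (Pi.single j 1) t := by
    intro t
    have := ((hasDerivAt_id t).smul_const (Pi.single j 1 : Fin n → ℂ)).const_add z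
    simpa using this
  have hdiff : HasFDerivAt (ev f) (fderiv ℂ (ev f) z) (z + (0 : ℂ) • (Pi.single j 1 : Fin n → ℂ)) := by
    rw [zero_smul, add_zero]
    refine ((ev_analytic (ρ := ρ' + δ) (by positivity) hf z ?_).differentiableAt).hasFDerivAt
    rw [mem_ball_zero_iff]
    refine hz.trans_le ?_
    push_cast
    simp
  have hd1 : HasDerivAt (fun t : ℂ => ev f (z + t • (Pi.single j 1 : Fin n → ℂ)))
      (fderiv ℂ (ev f) z (Pi.single j 1)) 0 := by
    exact HasFDerivAt.comp_hasDerivAt (f := fun t : ℂ => z + t • (Pi.single j 1 : Fin n → ℂ)) 0 hdiff (hline 0)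
  set ε : ℝ := ρ' - ‖z‖ with hε
  have hεp : 0 < ε := by rw [hε]; linarith
  have hnorm : ∀ t ∈ Metric.ball (0 : ℂ) ε, ‖z + t • (Pi.single j 1 : Fin n → ℂ)‖ ≤ ρ' := by
    intro t ht
    rw [mem_ball_zero_iff] at ht
    have h1 : ‖t • (Pi.single j 1 : Fin n → ℂ)‖ ≤ ‖t‖ := by
      rw [norm_smul, Pi.norm_single]; simp
    have := norm_add_le z (t • (Pi.single j 1 : Fin n → ℂ))
    linarith
  let u : (Fin n →₀ ℕ) → ℝ := fun α => (δ : ℝ)⁻¹ * (‖MvPowerSeries.coeff α f‖ * ((ρ' : ℝ) + δ) ^ Finsupp.degree α)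
  have hu : Summable u := by
    refine Summable.mul_left _ ?_
    have hf' : wN (rwt n (ρ' + δ)) f ≠ ⊤ := hf
    have h1 : ∀ α, ‖MvPowerSeries.coeff α f‖ₑ * rwt n (ρ' + δ) α =
        ‖MvPowerSeries.coeff α f * ((((ρ' + δ : ℝ≥0) : ℝ) : ℂ)) ^ Finsupp.degree α‖ₑ := by
      intro α
      rw [enorm_mul, enorm_pow, rwt]
      congr 2
      rw [enorm_eq_nnnorm]
      congr 1
      ext
      rw [coe_nnnorm, Complex.norm_real, NNReal.norm_eq]
    unfold wN at hf'
    simp_rw [h1] at hf'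
    rw [tsum_enorm_ne_top_iff_summable_norm] at hf'
    refine hf'.congr fun α => ?_
    rw [norm_mul, norm_pow]
    congr 2
    rw [Complex.norm_real, NNReal.norm_eq]
    push_cast; rfl
  have hd2 := hasDerivAt_tsum_of_isPreconnected (𝕜 := ℂ) (u := u)
    (g := fun α t => MvPowerSeries.coeff α f * mono (z + t • (Pi.single j 1 : Fin n → ℂ)) α)
    (g' := fun α t => MvPowerSeries.coeff α f *
      (α j * mono (z + t • (Pi.single j 1 : Fin n → ℂ)) (α - Finsupp.single j 1)))
    (t := Metric.ball 0 ε) (y₀ := 0) (y := 0) hu Metric.isOpen_ball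
    ((convex_ball _ _).isPreconnected) (fun α t _ => (mono_deriv z j α t).const_mul _) ?_
    (Metric.mem_ball_self hεp) ?_ (Metric.mem_ball_self hεp)
  · have h3 := hd1.unique hd2
    rw [h3]
    unfold ev
    rw [← Function.Injective.tsum_eq (g := fun β : Fin n →₀ ℕ => β + Finsupp.single j 1)
      (fun a b h => add_right_cancel h)]
    · refine tsum_congr fun β => ?_
      rw [MvPowerSeries.coeff_pderiv]
      simp
      ring
    · intro α hα
      by_cases h0 : α j = 0
      · simp [h0] at hα
      · refine ⟨α - Finsupp.single j 1, ?_⟩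
        apply tsub_add_cancel_of_le
        rw [Finsupp.single_le_iff]; omega
  · intro α t ht
    by_cases h0 : α j = 0
    · simp only [h0, Nat.cast_zero, zero_mul, mul_zero, norm_zero, u]
      positivity
    · obtain ⟨β, rfl⟩ : ∃ β : Fin n →₀ ℕ, α = β + Finsupp.single j 1 := by
        refine ⟨α - Finsupp.single j 1, ?_⟩
        symm
        apply tsub_add_cancel_of_le
        rw [Finsupp.single_le_iff]; omega
      rw [add_tsub_cancel_right, norm_mul, norm_mul]
      simp only [u]
      rw [mul_left_comm (δ : ℝ)⁻¹]
      refine mul_le_mul_of_nonneg_left ?_ (norm_nonneg _)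
      have h5 : ((δ:ℝ))⁻¹ * ((ρ':ℝ) + δ) ^ Finsupp.degree (β + Finsupp.single j 1) =
        ((ρ':ℝ) + δ) ^ Finsupp.degree (β + Finsupp.single j 1) / δ := by ring
      rw [h5, le_div_iff₀ (by exact_mod_cast hδ)]
      have h6 := bern_aux ρ' δ (Finsupp.degree β)
      have h7 : ((((Finsupp.degree β : ℕ) : ℝ) + 1) * δ * ρ' ^ (Finsupp.degree β) : ℝ) ≤ ((ρ':ℝ) + δ) ^ (Finsupp.degree β + 1) := by
        exact_mod_cast h6
      rw [map_add, Finsupp.degree_single]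
      refine le_trans ?_ h7
      have h8 : ‖mono (z + t • (Pi.single j 1 : Fin n → ℂ)) β‖ ≤ (ρ' : ℝ) ^ Finsupp.degree β :=
        (mono_norm _ _).trans (pow_le_pow_left₀ (norm_nonneg _) (hnorm t ht) _)
      have h9 : (((β + Finsupp.single j 1 : Fin n →₀ ℕ) j : ℕ) : ℝ) ≤ ((Finsupp.degree β : ℕ) : ℝ) + 1 := by
        have : β j ≤ Finsupp.degree β := Finsupp.le_degree j β
        simp
        exact_mod_cast this
      rw [Complex.norm_natCast]
      calc _ ≤ (((Finsupp.degree β : ℕ) : ℝ) + 1) * (ρ' : ℝ) ^ Finsupp.degree β * δ := by gcongr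
        _ = _ := by ring
  · simp only [zero_smul, add_zero]
    exact (ev_summable hf z (hz.le.trans (by push_cast; simp))).of_norm

theorem exists_series {n : ℕ} {f : (Fin n → ℂ) → ℂ} (hf : AnalyticAt ℂ f 0) :
    ∃ ρ : ℝ≥0, 0 < ρ ∧ ∃ F ∈ Oρ n ρ, ∀ z, ‖z‖ < ρ → f z = ev F z := by
  classical
  obtain ⟨p, r, hp⟩ := hf
  obtain ⟨r', hr'0, hr'⟩ : ∃ r' : ℝ≥0, 0 < r' ∧ (r' : ℝ≥0∞) < r := by
    obtain ⟨q, h1, h2⟩ := ENNReal.lt_iff_exists_nnreal_btwn.1 hp.r_pos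
    exact ⟨q, by exact_mod_cast h1, h2⟩
  let ρ : ℝ≥0 := r' / (n + 1)
  have hρ0 : 0 < ρ := by positivity
  have hnρ : (n : ℝ≥0) * ρ ≤ r' := by
    simp only [ρ]
    rw [mul_div_assoc', div_le_iff₀ (by positivity), mul_comm]
    gcongr
    simp
  have hρr : ρ ≤ r' := by
    simp only [ρ]
    exact div_le_self (by positivity) (by simp)
  have hsum : Summable fun k => ‖p k‖₊ * r' ^ k :=
    p.summable_nnnorm_mul_pow (hr'.trans_le hp.r_le)
  -- words
  let W := Σ k : ℕ, (Fin k → Fin n)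
  let cnt : W → (Fin n →₀ ℕ) := fun b => ∑ l, Finsupp.single (b.2 l) 1
  let A : W → ℂ := fun b => p b.1 (fun l => Pi.single (b.2 l) 1)
  have hdeg : ∀ b, Finsupp.degree (cnt b) = b.1 := by
    intro b
    simp [cnt]
  have hmono : ∀ (z : Fin n → ℂ) b, mono z (cnt b) = ∏ l, z (b.2 l) := by
    intro z b
    simp only [cnt]
    rw [mono_sum]
    simp [mono_single]
  have hA : ∀ b, ‖A b‖ₑ ≤ ‖p b.1‖ₑ := by
    intro b
    have h1 : ‖A b‖ ≤ ‖p b.1‖ := by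
      refine ((p b.1).le_opNorm _).trans ?_
      simp [Pi.norm_single]
    exact enorm_le_iff_norm_le.2 h1
  have hfin : ∑' b : W, ‖A b‖ₑ * rwt n ρ (cnt b) ≠ ⊤ := by
    rw [← ENNReal.tsum_coe_ne_top_iff_summable] at hsum
    refine ne_top_of_le_ne_top hsum ?_
    rw [ENNReal.tsum_sigma']
    refine ENNReal.tsum_le_tsum fun k => ?_
    rw [tsum_fintype]
    calc ∑ v : Fin k → Fin n, ‖A ⟨k, v⟩‖ₑ * rwt n ρ (cnt ⟨k, v⟩)
        ≤ ∑ v : Fin k → Fin n, ‖p k‖ₑ * (ρ : ℝ≥0∞) ^ k := by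
          refine Finset.sum_le_sum fun v _ => ?_
          rw [rwt, hdeg]
          exact mul_le_mul_left (hA ⟨k, v⟩) _
      _ = ((‖p k‖₊ * ((n : ℝ≥0) * ρ) ^ k : ℝ≥0) : ℝ≥0∞) := by
          rw [Finset.sum_const, Finset.card_univ, Fintype.card_fun, Fintype.card_fin, Fintype.card_fin,
            nsmul_eq_mul, enorm_eq_nnnorm]
          push_cast
          ring
      _ ≤ _ := by
          gcongr
  let F : MvPowerSeries (Fin n) ℂ := fun α => ∑' b : cnt ⁻¹' {α}, A b
  have hFc : ∀ α, MvPowerSeries.coeff α F = ∑' b : cnt ⁻¹' {α}, A b := fun _ => rfl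
  have hFm : F ∈ Oρ n ρ := by
    refine ne_top_of_le_ne_top hfin ?_
    rw [← ENNReal.tsum_fiberwise _ cnt]
    refine ENNReal.tsum_le_tsum fun α => ?_
    rw [hFc]
    have h1 : ∀ b : cnt ⁻¹' {α}, ‖A b‖ₑ * rwt n ρ (cnt b) = ‖A b‖ₑ * rwt n ρ α := by
      intro b
      have : cnt b = α := b.2
      rw [this]
    simp_rw [h1]
    rw [ENNReal.tsum_mul_right]
    exact mul_le_mul_left enorm_tsum_le_tsum_enorm _
  refine ⟨ρ, hρ0, F, hFm, fun z hz => ?_⟩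
  have hs1 : Summable fun b : W => A b * mono z (cnt b) := by
    apply Summable.of_norm
    rw [← tsum_enorm_ne_top_iff_summable_norm]
    refine ne_top_of_le_ne_top hfin (ENNReal.tsum_le_tsum fun b => ?_)
    rw [enorm_mul]
    exact mul_le_mul_right (mono_enorm z hz.le _) _
  have hpk : ∀ k, (p k fun _ => z) = ∑ v : Fin k → Fin n, A ⟨k, v⟩ * mono z (cnt ⟨k, v⟩) := by
    intro k
    have hz' : z = ∑ i, z i • (Pi.single i 1 : Fin n → ℂ) := by
      ext j
      simp [Finset.sum_apply, Pi.single_apply]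
    conv_lhs => rw [hz']
    rw [ContinuousMultilinearMap.map_sum]
    refine Finset.sum_congr rfl fun v _ => ?_
    rw [ContinuousMultilinearMap.map_smul_univ, hmono, smul_eq_mul, mul_comm]
  have e1 : HasSum (fun k => p k fun _ => z) (f z) := by
    have := hp.hasSum (y := z) (by
      rw [Metric.mem_eball, edist_zero_right]
      refine lt_trans ?_ hr'
      rw [enorm_eq_nnnorm]
      have : ‖z‖₊ < ρ := by exact_mod_cast hz
      exact_mod_cast this.trans_le hρr)
    rwa [zero_add] at this
  have e2 : HasSum (fun k => p k fun _ => z) (∑' b : W, A b * mono z (cnt b)) := by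
    refine hs1.hasSum.sigma fun k => ?_
    rw [hpk]
    exact hasSum_fintype _
  rw [e1.unique e2]
  have e3 := hs1.hasSum.tsum_fiberwise cnt
  rw [← e3.tsum_eq]
  unfold ev
  refine tsum_congr fun α => ?_
  rw [hFc, ← tsum_mul_right]
  refine tsum_congr fun b => ?_
  have : cnt b = α := b.2
  rw [this]

theorem main_zero_case (n : ℕ) (hn : 0 < n) (U : Set (Fin n → ℂ)) (hU : IsOpen U)
    (h0U : (0 : Fin n → ℂ) ∈ U)
    (f : Fin n → (Fin n → ℂ) → ℂ) (hf : ∀ i, AnalyticOnNhd ℂ (f i) U)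
    (h : (Fin n → ℂ) → ℂ) (hh : AnalyticOnNhd ℂ h U) (h0 : h 0 = 0) :
    ∃ U' ⊆ U, IsOpen U' ∧ (0 : Fin n → ℂ) ∈ U' ∧
      ∃ a : Fin n → (Fin n → ℂ) → ℂ,
        (∀ i, AnalyticOnNhd ℂ (a i) U') ∧
        ∀ z ∈ U', h z * Matrix.det (Matrix.of fun i j : Fin n =>
            fderiv ℂ (f i) z (Pi.single j 1)) = ∑ i, a i z * f i z := by
  classical
  have : Nonempty (Fin n) := ⟨⟨0, hn⟩⟩
  choose r hr F hF hFe using fun i => exists_series (hf i 0 h0U)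
  obtain ⟨rh, hrh, H, hH, hHe⟩ := exists_series (hh 0 h0U)
  obtain ⟨i₀, hi₀⟩ := Finite.exists_min r
  let ρ₀ : ℝ≥0 := min (r i₀) rh
  have hρ₀ : 0 < ρ₀ := lt_min (hr i₀) hrh
  let δ : ℝ≥0 := ρ₀ / 2
  have hδ : 0 < δ := by positivity
  have hδ2 : δ + δ = ρ₀ := add_halves ρ₀
  have hδle : δ ≤ ρ₀ := by rw [← hδ2]; simp
  have hF0 : ∀ i, F i ∈ Oρ n (δ + δ) := fun i => by
    rw [hδ2]; exact Oρ_mono ((min_le_left _ _).trans (hi₀ i)) (hF i)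
  have hH0 : H ∈ Oρ n ρ₀ := Oρ_mono (min_le_right _ _) hH
  have hD : ∀ i j, MvPowerSeries.pderiv ℂ j (F i) ∈ Oρ n δ := fun i j => pderiv_mem hδ (hF0 i) j
  have hcc : MvPowerSeries.constantCoeff H = 0 := by
    rw [← ev_at_zero, ← hHe 0 (by simpa using hrh), h0]
  obtain ⟨a, ha, hEq⟩ := formal_thm F (fun i => ⟨r i, hr i, hF i⟩) (fun i j => ⟨δ, hδ, hD i j⟩) H
    ⟨rh, hrh, hH⟩ hcc
  choose s hs has using ha
  obtain ⟨i₁, hi₁⟩ := Finite.exists_min s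
  let ρ : ℝ≥0 := min δ (s i₁)
  have hρ : 0 < ρ := lt_min hδ (hs i₁)
  have hρδ : ρ ≤ δ := min_le_left _ _
  have haρ : ∀ i, a i ∈ Oρ n ρ := fun i => Oρ_mono ((min_le_right _ _).trans (hi₁ i)) (has i)
  have hFρ : ∀ i, F i ∈ Oρ n ρ := fun i =>
    Oρ_mono ((hρδ.trans hδle).trans ((min_le_left _ _).trans (hi₀ i))) (hF i)
  have hHρ : H ∈ Oρ n ρ := Oρ_mono (hρδ.trans hδle) hH0
  have hDρ : ∀ i j, MvPowerSeries.pderiv ℂ j (F i) ∈ Oρ n ρ := fun i j => Oρ_mono hρδ (hD i j)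
  refine ⟨U ∩ Metric.ball 0 ρ, Set.inter_subset_left, hU.inter Metric.isOpen_ball,
    ⟨h0U, Metric.mem_ball_self (by exact_mod_cast hρ)⟩, fun i => ev (a i),
    fun i => (ev_analytic hρ (haρ i)).mono Set.inter_subset_right, ?_⟩
  rintro z ⟨-, hz⟩
  have hz1 : ‖z‖ < ρ := by simpa using hz
  have hball : ∀ i, ∀ w ∈ Metric.ball (0 : Fin n → ℂ) ρ, f i w = ev (F i) w := by
    intro i w hw
    refine hFe i w ?_
    have hw1 : ‖w‖ < ρ := by simpa using hw
    refine hw1.trans_le ?_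
    exact_mod_cast (hρδ.trans hδle).trans ((min_le_left _ _).trans (hi₀ i))
  have hfd : ∀ i j, fderiv ℂ (f i) z (Pi.single j 1) = ev (MvPowerSeries.pderiv ℂ j (F i)) z := by
    intro i j
    have h1 : f i =ᶠ[nhds z] ev (F i) := by
      filter_upwards [Metric.isOpen_ball.mem_nhds hz] with w hw using hball i w hw
    rw [h1.fderiv_eq]
    exact ev_fderiv hδ (hF0 i) j z (hz1.trans_le (by exact_mod_cast hρδ))
  have hhz : h z = ev H z := by
    refine hHe z (hz1.trans_le ?_)
    exact_mod_cast (hρδ.trans hδle).trans (min_le_right _ _)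
  let Φ := evHom ρ z hz1.le
  have hΦ : ∀ g : Oρ n ρ, Φ g = ev g.1 z := fun _ => rfl
  let M : Matrix (Fin n) (Fin n) (Oρ n ρ) :=
    Matrix.of fun i j => ⟨MvPowerSeries.pderiv ℂ j (F i), hDρ i j⟩
  have hM : (M.det : MvPowerSeries (Fin n) ℂ) =
      Matrix.det (Matrix.of fun i j => MvPowerSeries.pderiv ℂ j (F i)) :=
    (Oρ n ρ).subtype.map_det M
  have hEq' : (⟨H, hHρ⟩ : Oρ n ρ) * M.det = ∑ i, (⟨a i, haρ i⟩ : Oρ n ρ) * ⟨F i, hFρ i⟩ := by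
    apply Subtype.ext
    rw [AddSubmonoidClass.coe_finsetSum]
    have e1 : ((⟨H, hHρ⟩ : Oρ n ρ) * M.det).1 = H * (M.det).1 := rfl
    rw [e1, hM, hEq]
    rfl
  have hfin := congrArg Φ hEq'
  rw [map_mul, map_sum, RingHom.map_det] at hfin
  simp only [hΦ] at hfin
  rw [hhz]
  have e2 : (Matrix.of fun i j : Fin n => fderiv ℂ (f i) z (Pi.single j 1)) = Φ.mapMatrix M := by
    ext i j
    simp only [Matrix.of_apply, hfd]
    rfl
  rw [e2, hfin]
  exact Finset.sum_congr rfl fun i _ => by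
    rw [hball i z hz]
    exact ev_mul (haρ i) (hFρ i) z hz1.le

/-- If `h` is holomorphic on `U` and vanishes on the common zero set of `f_1, …, f_n`,
then `h · J(f_1, …, f_n)` lies in the ideal `(f_1, …, f_n)` locally at `0`. -/
theorem mul_jacobian_mem_ideal_of_vanishing
    (n : ℕ) (hn : 0 < n) (U : Set (Fin n → ℂ)) (hU : IsOpen U)
    (h0U : (0 : Fin n → ℂ) ∈ U)
    (f : Fin n → (Fin n → ℂ) → ℂ) (hf : ∀ i, AnalyticOnNhd ℂ (f i) U)
    (h : (Fin n → ℂ) → ℂ) (hh : AnalyticOnNhd ℂ h U)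
    (hvan : ∀ z ∈ U, (∀ i : Fin n, f i z = 0) → h z = 0) :
    ∃ U' ⊆ U, IsOpen U' ∧ (0 : Fin n → ℂ) ∈ U' ∧
      ∃ a : Fin n → (Fin n → ℂ) → ℂ,
        (∀ i, AnalyticOnNhd ℂ (a i) U') ∧
        ∀ z ∈ U', h z * Matrix.det (Matrix.of fun i j : Fin n =>
            fderiv ℂ (f i) z (Pi.single j 1)) = ∑ i, a i z * f i z := by
  classical
  by_cases h0 : h 0 = 0
  · exact main_zero_case n hn U hU h0U f hf h hh h0
  · obtain ⟨i₀, hi₀⟩ : ∃ i, f i 0 ≠ 0 := by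
      by_contra hcon
      push Not at hcon
      exact h0 (hvan 0 h0U hcon)
    have hopen : IsOpen (U ∩ {z | f i₀ z ≠ 0}) :=
      (hf i₀).continuousOn.isOpen_inter_preimage hU isOpen_ne
    have hfd : ∀ i j, AnalyticOnNhd ℂ (fun z => fderiv ℂ (f i) z (Pi.single j 1)) U := by
      intro i j z hz
      exact ((ContinuousLinearMap.apply ℂ ℂ (Pi.single j 1 : Fin n → ℂ)).analyticAt _).comp
        ((hf i).fderiv z hz)
    have hJ : AnalyticOnNhd ℂ (fun z => Matrix.det (Matrix.of fun i j : Fin n =>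
            fderiv ℂ (f i) z (Pi.single j 1))) U := by
      simp only [Matrix.det_apply, Matrix.of_apply]
      refine Finset.analyticOnNhd_fun_sum _ fun σ _ => ?_
      intro z hz
      have h2 : AnalyticAt ℂ (fun z => ∏ i, fderiv ℂ (f (σ i)) z (Pi.single i 1)) z :=
        Finset.analyticAt_fun_prod _ fun i _ => hfd (σ i) i z hz
      have h3 : AnalyticAt ℂ (fun z => ((Equiv.Perm.sign σ : ℤ) : ℂ) *
        ∏ i, fderiv ℂ (f (σ i)) z (Pi.single i 1)) z := analyticAt_const.mul h2
      refine h3.congr (Filter.Eventually.of_forall fun w => ?_)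
      simp [Units.smul_def]
    refine ⟨U ∩ {z | f i₀ z ≠ 0}, Set.inter_subset_left, hopen, ⟨h0U, hi₀⟩,
      fun i z => if i = i₀ then h z * Matrix.det (Matrix.of fun i j : Fin n =>
            fderiv ℂ (f i) z (Pi.single j 1)) / f i₀ z else 0, ?_, ?_⟩
    · intro i z hz
      by_cases hi : i = i₀
      · simp only [hi, if_true]
        exact ((hh z hz.1).mul (hJ z hz.1)).div (hf i₀ z hz.1) hz.2
      · simp only [hi, if_false]
        exact analyticAt_const
    · intro z hz
      rw [Finset.sum_eq_single i₀]
      · beta_reduce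
        rw [if_pos rfl, div_mul_cancel₀ _ hz.2]
      · intro i _ hi
        beta_reduce
        rw [if_neg hi, zero_mul]
      · simp
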